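/- r-th level scaled-cancellation recursion for the second T-sequence: in the r-th level interpolating setup with q₀ > q₁ > … > q_r > 0 strictly decreasing, for every k₁ ∈ {1,…,r}: Σ_{i₁=1}^{l} Σ_{i₂=1}^{l} β_{i₁} ‖y^{(i₂)}‖₂ (√(1−t)/√(q_{k₁}−q_{k₁+1})) T^q_{k₁+1,2}(i₁,i₂) = Σ_{i₁=1}^{l} Σ_{i₂=1}^{l} β_{i₁} ‖y^{(i₂)}‖₂ (√(1−t)/√(q_{k₁−1}−q_{k₁})) T^q_{k₁,2}(i₁,i₂) − (1−t) s β² (𝔪_{k₁} − 𝔪_{k₁+1}) E_{G,𝒰_{r+1}}⟨(x^{(p₁)})ᵀx^{(i₁)} ‖y^{(i₂)}‖₂‖y^{(p₂)}‖₂⟩_{γ_{k₁+1}^{(r)}}. -/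

import Mathlib

set_option linter.unusedVariables false

open MeasureTheory Real

namespace SFLR

noncomputable section

/-- The sample space of one group `𝒰_k = (u^{(4,k)}, u^{(2,k)}, h^{(k)})`. -/
abbrev Us (m n : ℕ) : Type := ℝ × (Fin m → ℝ) × (Fin n → ℝ)

/-- Standard Gaussian measure on `ℝ`. -/
def stdG : Measure ℝ := ProbabilityTheory.gaussianReal 0 1

/-- i.i.d. standard Gaussian vector measure. -/
def gVec (d : ℕ) : Measure (Fin d → ℝ) := Measure.pi fun _ => stdG

/-- i.i.d. standard Gaussian matrix measure. -/
def gMat (m n : ℕ) : Measure (Fin m → Fin n → ℝ) := Measure.pi fun _ => gVec n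

/-- Law of one group `𝒰_k`. -/
def muU (m n : ℕ) : Measure (Us m n) := stdG.prod ((gVec m).prod (gVec n))

/-- Joint law of `(G, (𝒰_k)_{k=1}^{r+1})`; the `k`-th group `𝒰_k` is coordinate `k-1`. -/
def muAll (r m n : ℕ) : Measure ((Fin m → Fin n → ℝ) × (Fin (r+1) → Us m n)) :=
  (gMat m n).prod (Measure.pi fun _ : Fin (r+1) => muU m n)

/-- Euclidean norm. -/
def nrm2 {d : ℕ} (v : Fin d → ℝ) : ℝ := Real.sqrt (∑ i, v i ^ 2)

/-- Euclidean inner product. -/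
def dotv {d : ℕ} (a b : Fin d → ℝ) : ℝ := ∑ i, a i * b i

variable {m n l : ℕ}

/-- The `r`-th level interpolating exponent `D₀^{(i₁,i₂)}`; the factor `ε` multiplies the
`u^{(4,k)}`-terms (`ε = 1` gives `D₀`, `ε = 0` gives `D_{0,S}`). -/
def D0R (r : ℕ) (ε β s t : ℝ) (mv p q : ℕ → ℝ) (x : Fin l → Fin n → ℝ) (y : Fin l → Fin m → ℝ)
    (G : Fin m → Fin n → ℝ) (U : Fin (r+1) → Us m n) (i1 i2 : Fin l) : ℝ :=
  Real.sqrt t * (∑ j, ∑ k, y i2 j * (G j k * x i1 k))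
    + Real.sqrt (1 - t) * nrm2 (x i1) *
        (∑ j, y i2 j * (∑ k : Fin (r+1), Real.sqrt (p (k : ℕ) - p ((k : ℕ) + 1)) * (U k).2.1 j))
    + ε * (Real.sqrt t * nrm2 (x i1) * nrm2 (y i2) *
        (∑ k : Fin (r+1),
          Real.sqrt (p (k : ℕ) * q (k : ℕ) - p ((k : ℕ) + 1) * q ((k : ℕ) + 1)) * (U k).1))
    + Real.sqrt (1 - t) * nrm2 (y i2) *
        (∑ kk, (∑ k : Fin (r+1), Real.sqrt (q (k : ℕ) - q ((k : ℕ) + 1)) * (U k).2.2 kk) * x i1 kk)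

/-- `A^{(i₁,i₂)}`. -/
def AR (r : ℕ) (ε β s t : ℝ) (mv p q : ℕ → ℝ) (x : Fin l → Fin n → ℝ) (y : Fin l → Fin m → ℝ)
    (G : Fin m → Fin n → ℝ) (U : Fin (r+1) → Us m n) (i1 i2 : Fin l) : ℝ :=
  Real.exp (β * D0R r ε β s t mv p q x y G U i1 i2)

/-- `C^{(i₁)}`. -/
def CR (r : ℕ) (ε β s t : ℝ) (mv p q : ℕ → ℝ) (x : Fin l → Fin n → ℝ) (y : Fin l → Fin m → ℝ)
    (G : Fin m → Fin n → ℝ) (U : Fin (r+1) → Us m n) (i1 : Fin l) : ℝ :=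
  ∑ i2, AR r ε β s t mv p q x y G U i1 i2

/-- `Z`. -/
def ZR (r : ℕ) (ε β s t : ℝ) (mv p q : ℕ → ℝ) (x : Fin l → Fin n → ℝ) (y : Fin l → Fin m → ℝ)
    (G : Fin m → Fin n → ℝ) (U : Fin (r+1) → Us m n) : ℝ :=
  ∑ i1, CR r ε β s t mv p q x y G U i1 ^ s

/-- `ζ_k`: successively integrated partition functions, `ζ₀ = Z`,
`ζ_k = E_{𝒰_k} ζ_{k-1}^{𝔪_k/𝔪_{k-1}}`. -/
def zetaR (r : ℕ) (ε β s t : ℝ) (mv p q : ℕ → ℝ) (x : Fin l → Fin n → ℝ)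
    (y : Fin l → Fin m → ℝ) (G : Fin m → Fin n → ℝ) : ℕ → (Fin (r+1) → Us m n) → ℝ
  | 0, U => ZR r ε β s t mv p q x y G U
  | k+1, U =>
      if h : k < r + 1 then
        ∫ u, zetaR r ε β s t mv p q x y G k (Function.update U ⟨k, h⟩ u) ^ (mv (k+1) / mv k)
          ∂ muU m n
      else 0

/-- The `r`-th level interpolating function `ψ`. -/
def psiR (r : ℕ) (ε β s t : ℝ) (mv p q : ℕ → ℝ) (x : Fin l → Fin n → ℝ)
    (y : Fin l → Fin m → ℝ) : ℝ :=
  ∫ ω, (β * |s| * Real.sqrt (n : ℝ) * mv r)⁻¹ *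
      Real.log (zetaR r ε β s t mv p q x y ω.1 r ω.2) ∂ muAll r m n

/-- The operator `Φ_{𝒰_k}` (for `k ≥ 1`). -/
def PhiR (r : ℕ) (ε β s t : ℝ) (mv p q : ℕ → ℝ) (x : Fin l → Fin n → ℝ)
    (y : Fin l → Fin m → ℝ) (k : ℕ)
    (f : (Fin m → Fin n → ℝ) → (Fin (r+1) → Us m n) → ℝ) :
    (Fin m → Fin n → ℝ) → (Fin (r+1) → Us m n) → ℝ :=
  fun G U =>
    if h : k - 1 < r + 1 then
      (∫ u, zetaR r ε β s t mv p q x y G (k-1) (Function.update U ⟨k-1, h⟩ u) ^ (mv k / mv (k-1))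
          * f G (Function.update U ⟨k-1, h⟩ u) ∂ muU m n) /
        zetaR r ε β s t mv p q x y G k U
    else 0

/-- `Φ_{𝒰_hi} ∘ ⋯ ∘ Φ_{𝒰_lo}` (identity when `hi < lo`). -/
def PhiUpToR (r : ℕ) (ε β s t : ℝ) (mv p q : ℕ → ℝ) (x : Fin l → Fin n → ℝ)
    (y : Fin l → Fin m → ℝ) (lo : ℕ) :
    ℕ → ((Fin m → Fin n → ℝ) → (Fin (r+1) → Us m n) → ℝ) →
      (Fin m → Fin n → ℝ) → (Fin (r+1) → Us m n) → ℝ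
  | 0, f => f
  | hi+1, f =>
      if hi + 1 < lo then f
      else PhiR r ε β s t mv p q x y (hi+1) (PhiUpToR r ε β s t mv p q x y lo hi f)

/-- `γ₀(i₁,i₂)`. -/
def gam0R (r : ℕ) (ε β s t : ℝ) (mv p q : ℕ → ℝ) (x : Fin l → Fin n → ℝ)
    (y : Fin l → Fin m → ℝ) (i1 i2 : Fin l) :
    (Fin m → Fin n → ℝ) → (Fin (r+1) → Us m n) → ℝ :=
  fun G U =>
    CR r ε β s t mv p q x y G U i1 ^ s / ZR r ε β s t mv p q x y G U *
      (AR r ε β s t mv p q x y G U i1 i2 / CR r ε β s t mv p q x y G U i1)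

/-- The measure `γ_{k₁+1}^{(r)}`. -/
def gamR (r : ℕ) (ε β s t : ℝ) (mv p q : ℕ → ℝ) (x : Fin l → Fin n → ℝ)
    (y : Fin l → Fin m → ℝ) (k1 : ℕ) (i1 i2 pp1 pp2 : Fin l) :
    (Fin m → Fin n → ℝ) → (Fin (r+1) → Us m n) → ℝ :=
  PhiUpToR r ε β s t mv p q x y (k1+1) r
    (fun G U =>
      PhiUpToR r ε β s t mv p q x y 1 k1 (gam0R r ε β s t mv p q x y i1 i2) G U *
        PhiUpToR r ε β s t mv p q x y 1 k1 (gam0R r ε β s t mv p q x y pp1 pp2) G U)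

/-- The measure `γ₀₁^{(r)}`. -/
def gam01R (r : ℕ) (ε β s t : ℝ) (mv p q : ℕ → ℝ) (x : Fin l → Fin n → ℝ)
    (y : Fin l → Fin m → ℝ) (i1 i2 : Fin l) :
    (Fin m → Fin n → ℝ) → (Fin (r+1) → Us m n) → ℝ :=
  PhiUpToR r ε β s t mv p q x y 1 r (gam0R r ε β s t mv p q x y i1 i2)

/-- The measure `γ₀₂^{(r)}`. -/
def gam02R (r : ℕ) (ε β s t : ℝ) (mv p q : ℕ → ℝ) (x : Fin l → Fin n → ℝ)
    (y : Fin l → Fin m → ℝ) (i1 i2 p2 : Fin l) :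
    (Fin m → Fin n → ℝ) → (Fin (r+1) → Us m n) → ℝ :=
  PhiUpToR r ε β s t mv p q x y 1 r
    (fun G U =>
      gam0R r ε β s t mv p q x y i1 i2 G U * gam0R r ε β s t mv p q x y i1 p2 G U)

/-- `E_{G,𝒰_{r+1}} ⟨f⟩_{γ_{k₁+1}^{(r)}}`. -/
def EBrR (r : ℕ) (ε β s t : ℝ) (mv p q : ℕ → ℝ) (x : Fin l → Fin n → ℝ)
    (y : Fin l → Fin m → ℝ) (k1 : ℕ) (f : Fin l → Fin l → Fin l → Fin l → ℝ) : ℝ :=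
  ∫ ω, (∑ i1, ∑ i2, ∑ pp1, ∑ pp2,
      f i1 i2 pp1 pp2 * gamR r ε β s t mv p q x y k1 i1 i2 pp1 pp2 ω.1 ω.2) ∂ muAll r m n

/-- `E_{G,𝒰_{r+1}} ⟨f⟩_{γ₀₁^{(r)}}`. -/
def EB01R (r : ℕ) (ε β s t : ℝ) (mv p q : ℕ → ℝ) (x : Fin l → Fin n → ℝ)
    (y : Fin l → Fin m → ℝ) (f : Fin l → Fin l → ℝ) : ℝ :=
  ∫ ω, (∑ i1, ∑ i2, f i1 i2 * gam01R r ε β s t mv p q x y i1 i2 ω.1 ω.2) ∂ muAll r m n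

/-- `E_{G,𝒰_{r+1}} ⟨f⟩_{γ₀₂^{(r)}}`. -/
def EB02R (r : ℕ) (ε β s t : ℝ) (mv p q : ℕ → ℝ) (x : Fin l → Fin n → ℝ)
    (y : Fin l → Fin m → ℝ) (f : Fin l → Fin l → Fin l → ℝ) : ℝ :=
  ∫ ω, (∑ i1, ∑ i2, ∑ p2, f i1 i2 p2 * gam02R r ε β s t mv p q x y i1 i2 p2 ω.1 ω.2)
    ∂ muAll r m n

/-- `E_{G,𝒰_{r+1}} ⟨‖x^{(i₁)}‖‖x^{(p₁)}‖‖y^{(i₂)}‖‖y^{(p₂)}‖⟩_{γ_{k₁+1}^{(r)}}`. -/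
def EXR (r : ℕ) (ε β s t : ℝ) (mv p q : ℕ → ℝ) (x : Fin l → Fin n → ℝ)
    (y : Fin l → Fin m → ℝ) (k1 : ℕ) : ℝ :=
  EBrR r ε β s t mv p q x y k1
    (fun i1 i2 pp1 pp2 => nrm2 (x i1) * nrm2 (x pp1) * nrm2 (y i2) * nrm2 (y pp2))

/-- The corrected interpolating function `ψ₁`. -/
def psi1R (r : ℕ) (ε β s t : ℝ) (mv p q : ℕ → ℝ) (x : Fin l → Fin n → ℝ)
    (y : Fin l → Fin m → ℝ) : ℝ :=
  -(Real.sign s * s * β / (2 * Real.sqrt (n : ℝ))) *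
      (∑ k ∈ Finset.range (r+1),
        mv (k+1) * (p k * q k * EXR r ε β s t mv p q x y k
          - p (k+1) * q (k+1) * EXR r ε β s t mv p q x y (k+1)))
    + psiR r ε β s t mv p q x y

/-- The component `u_j^{(2,k)}`. -/
def u2c {r m n : ℕ} (U : Fin (r+1) → Us m n) (k : ℕ) (j : Fin m) : ℝ :=
  if h : k - 1 < r + 1 then (U ⟨k-1, h⟩).2.1 j else 0

/-- The scalar `u^{(4,k)}`. -/
def u4c {r m n : ℕ} (U : Fin (r+1) → Us m n) (k : ℕ) : ℝ :=
  if h : k - 1 < r + 1 then (U ⟨k-1, h⟩).1 else 0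

/-- `u^{(i₁,3,k)} = (h^{(k)})ᵀ x^{(i₁)} / ‖x^{(i₁)}‖₂`. -/
def u3c {r m n l : ℕ} (x : Fin l → Fin n → ℝ) (U : Fin (r+1) → Us m n) (k : ℕ)
    (i1 : Fin l) : ℝ :=
  if h : k - 1 < r + 1 then dotv (U ⟨k-1, h⟩).2.2 (x i1) / nrm2 (x i1) else 0

/-- The nested conditional expectations
`E_{𝒰_v}(ζ_{v-1}^{𝔪_v/𝔪_{v-1}-1} ⋯ E_{𝒰₁}(ζ₀^{𝔪₁/𝔪₀-1} g) ⋯)`. -/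
def nestR (r : ℕ) (ε β s t : ℝ) (mv p q : ℕ → ℝ) (x : Fin l → Fin n → ℝ)
    (y : Fin l → Fin m → ℝ) (g : (Fin m → Fin n → ℝ) → (Fin (r+1) → Us m n) → ℝ) :
    ℕ → (Fin m → Fin n → ℝ) → (Fin (r+1) → Us m n) → ℝ
  | 0 => g
  | v+1 => fun G U =>
      if h : v < r + 1 then
        ∫ u, zetaR r ε β s t mv p q x y G v (Function.update U ⟨v, h⟩ u) ^
              (mv (v+1) / mv v - 1) *
            nestR r ε β s t mv p q x y g v G (Function.update U ⟨v, h⟩ u) ∂ muU m n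
      else 0

/-- `T^p_{k,1,j}(i₁,i₂)` at the `r`-th level. -/
def TpR (r : ℕ) (ε β s t : ℝ) (mv p q : ℕ → ℝ) (x : Fin l → Fin n → ℝ)
    (y : Fin l → Fin m → ℝ) (k : ℕ) (j : Fin m) (i1 i2 : Fin l) : ℝ :=
  ∫ ω, (zetaR r ε β s t mv p q x y ω.1 r ω.2)⁻¹ *
      nestR r ε β s t mv p q x y
        (fun G U => CR r ε β s t mv p q x y G U i1 ^ (s - 1) *
          AR r ε β s t mv p q x y G U i1 i2 * y i2 j * u2c U k j) r ω.1 ω.2 ∂ muAll r m n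

/-- `T^q_{k,2}(i₁,i₂)` at the `r`-th level. -/
def TqR (r : ℕ) (ε β s t : ℝ) (mv p q : ℕ → ℝ) (x : Fin l → Fin n → ℝ)
    (y : Fin l → Fin m → ℝ) (k : ℕ) (i1 i2 : Fin l) : ℝ :=
  ∫ ω, (zetaR r ε β s t mv p q x y ω.1 r ω.2)⁻¹ *
      nestR r ε β s t mv p q x y
        (fun G U => CR r ε β s t mv p q x y G U i1 ^ (s - 1) *
          AR r ε β s t mv p q x y G U i1 i2 * u3c x U k i1) r ω.1 ω.2 ∂ muAll r m n

/-- `T^{(p,q)}_{k,3}(i₁,i₂)` at the `r`-th level. -/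
def TpqR (r : ℕ) (ε β s t : ℝ) (mv p q : ℕ → ℝ) (x : Fin l → Fin n → ℝ)
    (y : Fin l → Fin m → ℝ) (k : ℕ) (i1 i2 : Fin l) : ℝ :=
  ∫ ω, (zetaR r ε β s t mv p q x y ω.1 r ω.2)⁻¹ *
      nestR r ε β s t mv p q x y
        (fun G U => CR r ε β s t mv p q x y G U i1 ^ (s - 1) *
          AR r ε β s t mv p q x y G U i1 i2 * u4c U k) r ω.1 ω.2 ∂ muAll r m n



section generic

variable {E F : Type*} [NormedAddCommGroup E] [MeasurableSpace E]
  [NormedAddCommGroup F] [MeasurableSpace F]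

/-- Exponentially bounded measurable functions. -/
def Tame (f : E → ℝ) : Prop :=
  Measurable f ∧ ∃ K L : ℝ, 0 ≤ K ∧ 0 ≤ L ∧ ∀ x, |f x| ≤ Real.exp (K + L * ‖x‖)

/-- Positive functions, exponentially bounded above and below. -/
def PosTame (f : E → ℝ) : Prop :=
  Tame f ∧ (∀ x, 0 < f x) ∧ Tame (fun x => (f x)⁻¹)

/-- Measures with all exponential moments of the norm. -/
def ExpInt (μ : Measure E) : Prop := ∀ L : ℝ, Integrable (fun x => Real.exp (L * ‖x‖)) μ

theorem Tame.const (c : ℝ) : Tame (fun _ : E => c) := by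
  refine ⟨measurable_const, |c|, 0, abs_nonneg _, le_rfl, fun x => ?_⟩
  have := Real.add_one_le_exp |c|
  simp only [zero_mul, add_zero]
  linarith

theorem Tame.mono {f g : E → ℝ} (hg : Tame g) (hf : Measurable f) (h : ∀ x, |f x| ≤ |g x|) :
    Tame f := by
  obtain ⟨_, K, L, hK, hL, hb⟩ := hg
  exact ⟨hf, K, L, hK, hL, fun x => (h x).trans (hb x)⟩

theorem Tame.mul {f g : E → ℝ} (hf : Tame f) (hg : Tame g) : Tame (fun x => f x * g x) := by
  obtain ⟨hfm, K, L, hK, hL, hb⟩ := hf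
  obtain ⟨hgm, K', L', hK', hL', hb'⟩ := hg
  refine ⟨hfm.mul hgm, K + K', L + L', by positivity, by positivity, fun x => ?_⟩
  rw [abs_mul]
  calc |f x| * |g x| ≤ Real.exp (K + L * ‖x‖) * Real.exp (K' + L' * ‖x‖) :=
        mul_le_mul (hb x) (hb' x) (abs_nonneg _) (Real.exp_pos _).le
    _ = _ := by rw [← Real.exp_add]; congr 1; ring

theorem Tame.add {f g : E → ℝ} (hf : Tame f) (hg : Tame g) : Tame (fun x => f x + g x) := by
  obtain ⟨hfm, K, L, hK, hL, hb⟩ := hf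
  obtain ⟨hgm, K', L', hK', hL', hb'⟩ := hg
  refine ⟨hfm.add hgm, 1 + K + K', L + L', by positivity, by positivity, fun x => ?_⟩
  have hx := norm_nonneg x
  have h1 : Real.exp (K + L * ‖x‖) ≤ Real.exp (K + L * ‖x‖ + (K' + L' * ‖x‖)) := by
    apply Real.exp_le_exp.2
    nlinarith [mul_nonneg hL' hx]
  have h2 : Real.exp (K' + L' * ‖x‖) ≤ Real.exp (K + L * ‖x‖ + (K' + L' * ‖x‖)) := by
    apply Real.exp_le_exp.2
    nlinarith [mul_nonneg hL hx]
  have h3 : Real.exp (1 + K + K' + (L + L') * ‖x‖)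
      = Real.exp 1 * Real.exp (K + L * ‖x‖ + (K' + L' * ‖x‖)) := by
    rw [← Real.exp_add]; congr 1; ring
  have h4 : (2:ℝ) ≤ Real.exp 1 := by linarith [Real.add_one_le_exp (1:ℝ)]
  have h5 := Real.exp_pos (K + L * ‖x‖ + (K' + L' * ‖x‖))
  rw [h3]
  calc |f x + g x| ≤ |f x| + |g x| := abs_add_le _ _
    _ ≤ 2 * Real.exp (K + L * ‖x‖ + (K' + L' * ‖x‖)) := by linarith [hb x, hb' x]
    _ ≤ _ := by nlinarith

theorem Tame.sum {ι : Type*} (S : Finset ι) {f : ι → E → ℝ} (hf : ∀ i ∈ S, Tame (f i)) :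
    Tame (fun x => ∑ i ∈ S, f i x) := by
  classical
  induction S using Finset.induction_on with
  | empty => simpa using Tame.const (E := E) 0
  | insert a S ha ih =>
    simp only [Finset.sum_insert ha]
    exact (hf a (by simp)).add (ih fun i hi => hf i (by simp [hi]))

theorem Tame.comp {f : E → ℝ} (hf : Tame f) {g : F → E} (hg : Measurable g) (c : ℝ)
    (hc : 0 ≤ c) (h : ∀ x, ‖g x‖ ≤ ‖x‖ + c) : Tame (fun x => f (g x)) := by
  obtain ⟨hfm, K, L, hK, hL, hb⟩ := hf
  refine ⟨hfm.comp hg, K + L * c, L, by positivity, hL, fun x => (hb _).trans ?_⟩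
  apply Real.exp_le_exp.2
  nlinarith [mul_le_mul_of_nonneg_left (h x) hL]

theorem Tame.integrable {f : E → ℝ} (hf : Tame f) {μ : Measure E} (hμ : ExpInt μ) :
    Integrable f μ := by
  obtain ⟨hfm, K, L, hK, hL, hb⟩ := hf
  refine ((hμ L).const_mul (Real.exp K)).mono' hfm.aestronglyMeasurable
    (Filter.Eventually.of_forall fun x => ?_)
  rw [← Real.exp_add]
  exact hb x

theorem Tame.rpow_nonneg {f : E → ℝ} (hf : Tame f) (h0 : ∀ x, 0 < f x) {a : ℝ} (ha : 0 ≤ a) :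
    Tame (fun x => f x ^ a) := by
  obtain ⟨hfm, K, L, hK, hL, hb⟩ := hf
  refine ⟨hfm.pow_const a, K * a, L * a, by positivity, by positivity, fun x => ?_⟩
  rw [abs_of_pos (Real.rpow_pos_of_pos (h0 x) _)]
  calc f x ^ a ≤ (Real.exp (K + L * ‖x‖)) ^ a :=
        Real.rpow_le_rpow (h0 x).le ((le_abs_self _).trans (hb x)) ha
    _ = _ := by rw [← Real.exp_mul]; congr 1; ring

theorem PosTame.rpow_tame {f : E → ℝ} (hf : PosTame f) (a : ℝ) : Tame (fun x => f x ^ a) := by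
  obtain ⟨h1, h2, h3⟩ := hf
  rcases le_total 0 a with ha | ha
  · exact h1.rpow_nonneg h2 ha
  · have := h3.rpow_nonneg (fun x => inv_pos.2 (h2 x)) (a := -a) (by linarith)
    convert this using 2 with x
    rw [Real.inv_rpow (h2 x).le, Real.rpow_neg (h2 x).le, inv_inv]

theorem PosTame.rpow {f : E → ℝ} (hf : PosTame f) (a : ℝ) : PosTame (fun x => f x ^ a) := by
  refine ⟨hf.rpow_tame a, fun x => Real.rpow_pos_of_pos (hf.2.1 x) _, ?_⟩
  convert hf.rpow_tame (-a) using 2 with x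
  rw [Real.rpow_neg (hf.2.1 x).le]

theorem PosTame.sum {ι : Type*} (S : Finset ι) (hS : S.Nonempty) {f : ι → E → ℝ}
    (hf : ∀ i ∈ S, PosTame (f i)) : PosTame (fun x => ∑ i ∈ S, f i x) := by
  have h1 : Tame (fun x => ∑ i ∈ S, f i x) := Tame.sum S fun i hi => (hf i hi).1
  have h2 : ∀ x, 0 < ∑ i ∈ S, f i x := fun x => Finset.sum_pos (fun i hi => (hf i hi).2.1 x) hS
  refine ⟨h1, h2, ?_⟩
  obtain ⟨i, hi⟩ := hS
  refine (hf i hi).2.2.mono h1.1.inv fun x => ?_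
  rw [abs_of_pos (inv_pos.2 (h2 x)), abs_of_pos (inv_pos.2 ((hf i hi).2.1 x))]
  apply inv_anti₀ ((hf i hi).2.1 x)
  exact Finset.single_le_sum (f := fun i => f i x) (fun j hj => ((hf j hj).2.1 x).le) hi

/-- Affinely bounded measurable functions. -/
def LinB (f : E → ℝ) : Prop := Measurable f ∧ ∃ L : ℝ, 0 ≤ L ∧ ∀ x, |f x| ≤ L * ‖x‖

theorem LinB.add {f g : E → ℝ} (hf : LinB f) (hg : LinB g) : LinB (fun x => f x + g x) := by
  obtain ⟨h1, L, hL, h2⟩ := hf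
  obtain ⟨h1', L', hL', h2'⟩ := hg
  refine ⟨h1.add h1', L + L', by positivity, fun x => ?_⟩
  have := abs_add_le (f x) (g x)
  linarith [h2 x, h2' x]

theorem LinB.const_mul {f : E → ℝ} (hf : LinB f) (c : ℝ) : LinB (fun x => c * f x) := by
  obtain ⟨h1, L, hL, h2⟩ := hf
  refine ⟨h1.const_mul c, |c| * L, by positivity, fun x => ?_⟩
  rw [abs_mul, mul_assoc]
  exact mul_le_mul_of_nonneg_left (h2 x) (abs_nonneg _)

theorem LinB.mul_const {f : E → ℝ} (hf : LinB f) (c : ℝ) : LinB (fun x => f x * c) := by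
  simpa only [mul_comm] using hf.const_mul c

theorem LinB.sum {ι : Type*} (S : Finset ι) {f : ι → E → ℝ} (hf : ∀ i ∈ S, LinB (f i)) :
    LinB (fun x => ∑ i ∈ S, f i x) := by
  classical
  induction S using Finset.induction_on with
  | empty => exact ⟨by simp, 0, le_rfl, by simp⟩
  | insert a S ha ih =>
    simp only [Finset.sum_insert ha]
    exact (hf a (by simp)).add (ih fun i hi => hf i (by simp [hi]))

theorem LinB.exp {f : E → ℝ} (hf : LinB f) : PosTame (fun x => Real.exp (f x)) := by
  obtain ⟨h1, L, hL, h2⟩ := hf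
  refine ⟨⟨h1.exp, 0, L, le_rfl, hL, fun x => ?_⟩, fun x => Real.exp_pos _,
    ⟨h1.exp.inv, 0, L, le_rfl, hL, fun x => ?_⟩⟩
  · rw [abs_of_pos (Real.exp_pos _), zero_add]
    exact Real.exp_le_exp.2 ((le_abs_self _).trans (h2 x))
  · beta_reduce
    rw [← Real.exp_neg, abs_of_pos (Real.exp_pos _), zero_add]
    exact Real.exp_le_exp.2 ((neg_le_abs _).trans (h2 x))

theorem LinB.tame {f : E → ℝ} (hf : LinB f) : Tame f := by
  obtain ⟨h1, L, hL, h2⟩ := hf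
  refine ⟨h1, 0, L, le_rfl, hL, fun x => (h2 x).trans ?_⟩
  linarith [Real.add_one_le_exp (0 + L * ‖x‖)]

theorem ExpInt.prod {μ : Measure E} {ν : Measure F} [SFinite μ] [SFinite ν]
    [OpensMeasurableSpace E] [OpensMeasurableSpace F]
    (hμ : ExpInt μ) (hν : ExpInt ν) : ExpInt (μ.prod ν) := by
  intro L
  refine ((hμ |L|).mul_prod (hν |L|)).mono' ?_ (Filter.Eventually.of_forall fun x => ?_)
  · have h1 : Measurable fun x : E × F => ‖x‖ := by
      have : (fun x : E × F => ‖x‖) = fun x => max ‖x.1‖ ‖x.2‖ := rfl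
      rw [this]
      exact (measurable_norm.comp measurable_fst).max (measurable_norm.comp measurable_snd)
    exact ((h1.const_mul L).exp).aestronglyMeasurable
  · rw [Real.norm_eq_abs, abs_of_pos (Real.exp_pos _), ← Real.exp_add]
    apply Real.exp_le_exp.2
    have h2 : ‖x‖ ≤ ‖x.1‖ + ‖x.2‖ := by
      rw [Prod.norm_def]
      exact max_le (by linarith [norm_nonneg x.2]) (by linarith [norm_nonneg x.1])
    calc L * ‖x‖ ≤ |L| * ‖x‖ := mul_le_mul_of_nonneg_right (le_abs_self _) (norm_nonneg _)
      _ ≤ |L| * (‖x.1‖ + ‖x.2‖) := mul_le_mul_of_nonneg_left h2 (abs_nonneg _)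
      _ = _ := by ring

theorem ExpInt.pi {ι : Type*} [Fintype ι] {μ : ι → Measure E} [∀ i, SigmaFinite (μ i)]
    [OpensMeasurableSpace E] [SecondCountableTopology E]
    (hμ : ∀ i, ExpInt (μ i)) : ExpInt (Measure.pi μ) := by
  intro L
  refine (Integrable.fintype_prod (fun i => hμ i |L|)).mono' ?_
    (Filter.Eventually.of_forall fun x => ?_)
  · have h1 : Measurable fun x : ι → E => ‖x‖ := measurable_norm
    exact ((h1.const_mul L).exp).aestronglyMeasurable
  · rw [Real.norm_eq_abs, abs_of_pos (Real.exp_pos _), ← Real.exp_sum]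
    apply Real.exp_le_exp.2
    rw [← Finset.mul_sum]
    have h2 : ‖x‖ ≤ ∑ i, ‖x i‖ := by
      rw [pi_norm_le_iff_of_nonneg (Finset.sum_nonneg fun i _ => norm_nonneg _)]
      intro i
      exact Finset.single_le_sum (f := fun i => ‖x i‖) (fun i _ => norm_nonneg _)
        (Finset.mem_univ i)
    calc L * ‖x‖ ≤ |L| * ‖x‖ := mul_le_mul_of_nonneg_right (le_abs_self _) (norm_nonneg _)
      _ ≤ _ := mul_le_mul_of_nonneg_left h2 (abs_nonneg _)

end generic

instance : IsProbabilityMeasure stdG := by unfold stdG; infer_instance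
instance (d : ℕ) : IsProbabilityMeasure (gVec d) := by unfold gVec; infer_instance
instance (m n : ℕ) : IsProbabilityMeasure (gMat m n) := by unfold gMat; infer_instance
instance (m n : ℕ) : IsProbabilityMeasure (muU m n) := by unfold muU; infer_instance
instance (r m n : ℕ) : IsProbabilityMeasure (muAll r m n) := by unfold muAll; infer_instance

theorem expInt_stdG : ExpInt stdG := by
  intro L
  exact ProbabilityTheory.integrable_exp_mul_abs (X := fun x => x)
    (ProbabilityTheory.integrable_exp_mul_gaussianReal L)
    (ProbabilityTheory.integrable_exp_mul_gaussianReal (-L))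

theorem expInt_gVec (d : ℕ) : ExpInt (gVec d) := ExpInt.pi fun _ => expInt_stdG
theorem expInt_gMat (m n : ℕ) : ExpInt (gMat m n) := ExpInt.pi fun _ => expInt_gVec n
theorem expInt_muU (m n : ℕ) : ExpInt (muU m n) :=
  expInt_stdG.prod ((expInt_gVec m).prod (expInt_gVec n))
theorem expInt_muAll (r m n : ℕ) : ExpInt (muAll r m n) :=
  (expInt_gMat m n).prod (ExpInt.pi fun _ => expInt_muU m n)

/-- Resampling one coordinate of a product measure. -/
theorem map_update_pi {ι : Type*} [Fintype ι] [DecidableEq ι] {X : ι → Type*}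
    [∀ i, MeasurableSpace (X i)] (μ : ∀ i, Measure (X i)) [∀ i, IsProbabilityMeasure (μ i)]
    (j : ι) :
    Measure.map (fun z : (∀ i, X i) × X j => Function.update z.1 j z.2)
      ((Measure.pi μ).prod (μ j)) = Measure.pi μ := by
  symm
  apply Measure.pi_eq
  intro S hS
  rw [Measure.map_apply measurable_update' (MeasurableSet.univ_pi hS)]
  have : (fun z : (∀ i, X i) × X j => Function.update z.1 j z.2) ⁻¹' (Set.univ.pi S)
      = (Set.univ.pi (Function.update S j Set.univ)) ×ˢ (S j) := by
    ext z
    simp only [Set.mem_preimage, Set.mem_univ_pi, Set.mem_prod]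
    constructor
    · intro h
      refine ⟨fun i => ?_, by simpa using h j⟩
      by_cases hi : i = j
      · subst hi; simp
      · simpa [hi] using h i
    · rintro ⟨h1, h2⟩ i
      by_cases hi : i = j
      · subst hi; simpa using h2
      · simpa [hi] using h1 i
  rw [this, Measure.prod_prod, Measure.pi_pi]
  rw [← Finset.mul_prod_erase _ _ (Finset.mem_univ j),
    ← Finset.mul_prod_erase (a := j) _ (fun i => (μ i) (S i)) (Finset.mem_univ j)]
  rw [Finset.prod_congr rfl (g := fun i => (μ i) (S i))]
  · simp [mul_comm]
  · intro i hi
    simp [Finset.ne_of_mem_erase hi]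

theorem integral_update_pi {ι : Type*} [Fintype ι] [DecidableEq ι] {X : ι → Type*}
    [∀ i, MeasurableSpace (X i)] (μ : ∀ i, Measure (X i)) [∀ i, IsProbabilityMeasure (μ i)]
    (j : ι) (f : (∀ i, X i) → ℝ) (hf : Integrable f (Measure.pi μ)) :
    ∫ h, f h ∂(Measure.pi μ) = ∫ h, ∫ z, f (Function.update h j z) ∂(μ j) ∂(Measure.pi μ) := by
  have hm : AEMeasurable (fun z : (∀ i, X i) × X j => Function.update z.1 j z.2)
      ((Measure.pi μ).prod (μ j)) := measurable_update'.aemeasurable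
  have hf' := hf
  rw [← map_update_pi μ j] at hf'
  conv_lhs => rw [← map_update_pi μ j]
  rw [integral_map hm hf'.aestronglyMeasurable]
  rw [integral_prod]
  exact (integrable_map_measure hf'.aestronglyMeasurable hm).1 (hf')

/-- One-dimensional Gaussian integration by parts. -/
theorem stein_one {f f' : ℝ → ℝ} (hf : Tame f) (hf' : Tame f')
    (hd : ∀ z, HasDerivAt f (f' z) z) :
    ∫ z, z * f z ∂stdG = ∫ z, f' z ∂stdG := by
  have hid : Tame (fun z : ℝ => z) :=
    LinB.tame ⟨measurable_id, 1, zero_le_one, fun z => by simp⟩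
  have key : ∀ g : ℝ → ℝ, Tame g →
      Integrable (fun z => g z * ProbabilityTheory.gaussianPDFReal 0 1 z) := by
    intro g hg
    have h := hg.integrable expInt_stdG
    unfold stdG at h
    rw [ProbabilityTheory.gaussianReal_of_var_ne_zero _ one_ne_zero,
      integrable_withDensity_iff_integrable_smul'] at h
    · refine h.congr (Filter.Eventually.of_forall fun z => ?_)
      simp [ProbabilityTheory.toReal_gaussianPDF, mul_comm]
    · exact ProbabilityTheory.measurable_gaussianPDF _ _
    · exact Filter.Eventually.of_forall fun z => ProbabilityTheory.gaussianPDF_lt_top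
  have hpd : ∀ z : ℝ, HasDerivAt (ProbabilityTheory.gaussianPDFReal 0 1)
      (-z * ProbabilityTheory.gaussianPDFReal 0 1 z) z := by
    intro z
    have h1 : HasDerivAt (fun z : ℝ => -(z - 0) ^ 2 / (2 * ((1 : NNReal) : ℝ))) (-z) z := by
      have := ((((hasDerivAt_id z).sub_const (0:ℝ)).pow 2).neg).div_const (2 * ((1 : NNReal) : ℝ))
      refine HasDerivAt.congr_deriv this ?_
      simp
      ring
    have := (h1.exp).const_mul (√(2 * π * ((1 : NNReal) : ℝ)))⁻¹
    refine HasDerivAt.congr_deriv this ?_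
    simp only [ProbabilityTheory.gaussianPDFReal]
    ring
  have h := integral_mul_deriv_eq_deriv_mul_of_integrable (u := f)
    (v := ProbabilityTheory.gaussianPDFReal 0 1) (u' := f')
    (v' := fun z => -z * ProbabilityTheory.gaussianPDFReal 0 1 z)
    (fun z _ => hd z) (fun z _ => hpd z) ?_ (key f' hf') (key f hf)
  · unfold stdG
    rw [ProbabilityTheory.integral_gaussianReal_eq_integral_smul one_ne_zero,
      ProbabilityTheory.integral_gaussianReal_eq_integral_smul one_ne_zero]
    simp only [smul_eq_mul]
    have e1 : ∀ z, ProbabilityTheory.gaussianPDFReal 0 1 z * (z * f z)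
        = -(f z * (-z * ProbabilityTheory.gaussianPDFReal 0 1 z)) := fun z => by ring
    have e2 : ∀ z, ProbabilityTheory.gaussianPDFReal 0 1 z * f' z
        = f' z * ProbabilityTheory.gaussianPDFReal 0 1 z := fun z => by ring
    simp only [e1, e2]
    rw [integral_neg, h, neg_neg]
  · refine (key _ (hid.mul hf)).neg.congr (Filter.Eventually.of_forall fun z => ?_)
    simp only [Pi.neg_apply, Pi.mul_apply]
    ring

section deriv

variable {E : Type*} [NormedAddCommGroup E] [NormedSpace ℝ E] [MeasurableSpace E]

/-- The second function is the directional derivative of `f` along `e`, both being tame. -/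
def DD (e : E) (f f' : E → ℝ) : Prop :=
  Tame f ∧ Tame f' ∧ ∀ ω, HasDerivAt (fun δ : ℝ => f (ω + δ • e)) (f' ω) 0

theorem DD.at {e : E} {f f' : E → ℝ} (h : DD e f f') (ω : E) (δ₀ : ℝ) :
    HasDerivAt (fun δ : ℝ => f (ω + δ • e)) (f' (ω + δ₀ • e)) δ₀ := by
  have h1 := h.2.2 (ω + δ₀ • e)
  have h2 : HasDerivAt (fun δ : ℝ => f (ω + δ₀ • e + (δ + -δ₀) • e)) (f' (ω + δ₀ • e)) δ₀ := by
    apply HasDerivAt.comp_add_const (f := fun δ : ℝ => f (ω + δ₀ • e + δ • e))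
    rw [add_neg_cancel]
    exact h1
  have h3 : (fun δ : ℝ => f (ω + δ • e)) = (fun δ : ℝ => f (ω + δ₀ • e + (δ + -δ₀) • e)) := by
    funext δ
    congr 1
    rw [add_assoc, ← add_smul]
    congr 2
    ring
  rw [h3]
  exact h2

theorem DD.congr {e : E} {f f' g g' : E → ℝ} (h : DD e f f') (hf : ∀ ω, f ω = g ω)
    (hf' : ∀ ω, f' ω = g' ω) : DD e g g' := by
  have h1 : f = g := funext hf
  have h2 : f' = g' := funext hf'
  rwa [← h1, ← h2]

theorem DD.mul {e : E} {f f' g g' : E → ℝ} (hf : DD e f f') (hg : DD e g g') :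
    DD e (fun ω => f ω * g ω) (fun ω => f' ω * g ω + f ω * g' ω) := by
  refine ⟨hf.1.mul hg.1, (hf.2.1.mul hg.1).add (hf.1.mul hg.2.1), fun ω => ?_⟩
  have := (hf.2.2 ω).mul (hg.2.2 ω)
  simp only [zero_smul, add_zero] at this
  exact this

theorem DD.const_mul {e : E} {f f' : E → ℝ} (hf : DD e f f') (c : ℝ) :
    DD e (fun ω => c * f ω) (fun ω => c * f' ω) :=
  ⟨(Tame.const c).mul hf.1, (Tame.const c).mul hf.2.1, fun ω => (hf.2.2 ω).const_mul c⟩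

theorem DD.sum {e : E} {ι : Type*} (S : Finset ι) {f f' : ι → E → ℝ}
    (hf : ∀ i ∈ S, DD e (f i) (f' i)) :
    DD e (fun ω => ∑ i ∈ S, f i ω) (fun ω => ∑ i ∈ S, f' i ω) :=
  ⟨Tame.sum S fun i hi => (hf i hi).1, Tame.sum S fun i hi => (hf i hi).2.1, fun ω =>
    HasDerivAt.fun_sum fun i hi => (hf i hi).2.2 ω⟩

theorem DD.rpow {e : E} {f f' : E → ℝ} (hf : DD e f f') (hp : PosTame f) (a : ℝ) :
    DD e (fun ω => f ω ^ a) (fun ω => a * f ω ^ (a - 1) * f' ω) := by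
  refine ⟨hp.rpow_tame a, ((Tame.const a).mul (hp.rpow_tame (a-1))).mul hf.2.1, fun ω => ?_⟩
  have := (hf.2.2 ω).rpow_const (p := a) (Or.inl (hp.2.1 _).ne')
  refine HasDerivAt.congr_deriv this ?_
  simp only [zero_smul, add_zero]
  ring

end deriv

/-- The full sample space. -/
abbrev Om (r m n : ℕ) : Type := (Fin m → Fin n → ℝ) × (Fin (r+1) → Us m n)

/-- Replace the `v`-th group. -/
def upd {r m n : ℕ} (v : Fin (r+1)) (ω : Om r m n) (u : Us m n) : Om r m n :=
  (ω.1, Function.update ω.2 v u)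

/-- Expectation over the `v`-th group. -/
def Ex {r m n : ℕ} (v : Fin (r+1)) (f : Om r m n → ℝ) (ω : Om r m n) : ℝ :=
  ∫ u, f (upd v ω u) ∂muU m n

section ex

variable {r : ℕ}

theorem norm_upd (v : Fin (r+1)) (ω : Om r m n) (u : Us m n) : ‖upd v ω u‖ ≤ ‖ω‖ + ‖u‖ := by
  have h1 := norm_fst_le ω
  have h2 := norm_snd_le ω
  unfold upd
  rw [Prod.norm_def]
  refine max_le (by simpa using h1.trans (le_add_of_nonneg_right (norm_nonneg u))) ?_
  rw [pi_norm_le_iff_of_nonneg (by positivity)]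
  intro i
  by_cases hi : i = v
  · subst hi
    simp
  · simp only [ne_eq, hi, not_false_eq_true, Function.update_of_ne]
    have := norm_le_pi_norm ω.2 i
    linarith [norm_nonneg u]

theorem measurable_upd (v : Fin (r+1)) :
    Measurable (fun z : Om r m n × Us m n => upd v z.1 z.2) := by
  unfold upd
  refine (measurable_fst.comp measurable_fst).prodMk ?_
  exact measurable_update'.comp ((measurable_snd.comp measurable_fst).prodMk measurable_snd)

theorem measurable_upd_right (v : Fin (r+1)) (ω : Om r m n) :
    Measurable (fun u : Us m n => upd v ω u) :=
  (measurable_upd v).comp (measurable_const.prodMk measurable_id)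

theorem tame_upd {f : Om r m n → ℝ} (hf : Tame f) (v : Fin (r+1)) (ω : Om r m n) :
    Tame (fun u => f (upd v ω u)) :=
  hf.comp (measurable_upd_right v ω) ‖ω‖ (norm_nonneg _) fun u =>
    (norm_upd v ω u).trans_eq (add_comm _ _)

theorem integrable_upd {f : Om r m n → ℝ} (hf : Tame f) (v : Fin (r+1)) (ω : Om r m n) :
    Integrable (fun u => f (upd v ω u)) (muU m n) :=
  (tame_upd hf v ω).integrable (expInt_muU m n)

theorem measurable_Ex {f : Om r m n → ℝ} (hf : Measurable f) (v : Fin (r+1)) :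
    Measurable (Ex v f) := by
  have h : StronglyMeasurable (fun z : Om r m n × Us m n => f (upd v z.1 z.2)) :=
    (hf.comp (measurable_upd v)).stronglyMeasurable
  exact (h.integral_prod_right' (ν := muU m n)).measurable

theorem tame_Ex {f : Om r m n → ℝ} (hf : Tame f) (v : Fin (r+1)) : Tame (Ex v f) := by
  refine ⟨measurable_Ex hf.1 v, ?_⟩
  obtain ⟨hfm, K, L, hK, hL, hb⟩ := hf
  set c := ∫ u, Real.exp (L * ‖u‖) ∂muU m n with hc
  have hc0 : 0 ≤ c := integral_nonneg fun u => (Real.exp_pos _).le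
  refine ⟨K + c, L, by positivity, hL, fun ω => ?_⟩
  unfold Ex
  calc |∫ u, f (upd v ω u) ∂muU m n|
      ≤ ∫ u, Real.exp (K + L * ‖ω‖) * Real.exp (L * ‖u‖) ∂muU m n := by
        rw [← Real.norm_eq_abs]
        refine norm_integral_le_of_norm_le ((expInt_muU m n L).const_mul _)
          (Filter.Eventually.of_forall fun u => ?_)
        rw [Real.norm_eq_abs, ← Real.exp_add]
        refine (hb _).trans (Real.exp_le_exp.2 ?_)
        nlinarith [mul_le_mul_of_nonneg_left (norm_upd v ω u) hL]
    _ = Real.exp (K + L * ‖ω‖) * c := by rw [integral_const_mul]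
    _ ≤ Real.exp (K + L * ‖ω‖) * Real.exp c := by
        apply mul_le_mul_of_nonneg_left _ (Real.exp_pos _).le
        linarith [Real.add_one_le_exp c]
    _ = _ := by rw [← Real.exp_add]; congr 1; ring

theorem posTame_Ex {f : Om r m n → ℝ} (hf : PosTame f) (v : Fin (r+1)) : PosTame (Ex v f) := by
  have h1 := tame_Ex hf.1 v
  obtain ⟨hfm, K, L, hK, hL, hb⟩ := hf.2.2
  set c := ∫ u, Real.exp ((-L) * ‖u‖) ∂muU m n with hc
  have hc0 : 0 < c := integral_exp_pos (expInt_muU m n (-L))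
  have hlow : ∀ ω, Real.exp (-(K + L * ‖ω‖)) * c ≤ Ex v f ω := by
    intro ω
    rw [hc, ← integral_const_mul]
    refine integral_mono ((expInt_muU m n (-L)).const_mul _) (integrable_upd hf.1 v ω)
      fun u => ?_
    beta_reduce
    rw [← Real.exp_add]
    have h2 := hb (upd v ω u)
    have h3 := hf.2.1 (upd v ω u)
    rw [abs_of_pos (inv_pos.2 h3)] at h2
    have h4 := inv_anti₀ (inv_pos.2 h3) h2
    rw [inv_inv, ← Real.exp_neg] at h4
    refine le_trans (Real.exp_le_exp.2 ?_) h4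
    nlinarith [mul_le_mul_of_nonneg_left (norm_upd v ω u) hL]
  have hpos : ∀ ω, 0 < Ex v f ω := fun ω =>
    lt_of_lt_of_le (mul_pos (Real.exp_pos _) hc0) (hlow ω)
  refine ⟨h1, hpos, h1.1.inv, K + c⁻¹, L, by positivity, hL, fun ω => ?_⟩
  beta_reduce
  rw [abs_of_pos (inv_pos.2 (hpos ω))]
  calc (Ex v f ω)⁻¹ ≤ (Real.exp (-(K + L * ‖ω‖)) * c)⁻¹ :=
        inv_anti₀ (mul_pos (Real.exp_pos _) hc0) (hlow ω)
    _ = Real.exp (K + L * ‖ω‖) * c⁻¹ := by rw [mul_inv, ← Real.exp_neg, neg_neg]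
    _ ≤ Real.exp (K + L * ‖ω‖) * Real.exp c⁻¹ := by
        apply mul_le_mul_of_nonneg_left _ (Real.exp_pos _).le
        linarith [Real.add_one_le_exp c⁻¹]
    _ = _ := by rw [← Real.exp_add]; congr 1; ring

theorem upd_add {v : Fin (r+1)} {e : Om r m n} (he : e.2 v = 0) (ω : Om r m n) (u : Us m n)
    (δ : ℝ) : upd v (ω + δ • e) u = upd v ω u + δ • e := by
  unfold upd
  ext1
  · simp
  · funext i
    by_cases hi : i = v
    · subst hi
      simp [he]
    · simp [hi]

theorem DD_Ex {v : Fin (r+1)} {e : Om r m n} (he : e.2 v = 0) {f f' : Om r m n → ℝ}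
    (hf : DD e f f') : DD e (Ex v f) (Ex v f') := by
  refine ⟨tame_Ex hf.1 v, tame_Ex hf.2.1 v, fun ω => ?_⟩
  unfold Ex
  simp only [upd_add he]
  obtain ⟨hfm, K, L, hK, hL, hb⟩ := hf.2.1
  have h := hasDerivAt_integral_of_dominated_loc_of_deriv_le (μ := muU m n) (x₀ := (0:ℝ))
    (s := Metric.ball 0 1) (F := fun δ u => f (upd v ω u + δ • e))
    (F' := fun δ u => f' (upd v ω u + δ • e))
    (bound := fun u => Real.exp (K + L * (‖ω‖ + ‖e‖)) * Real.exp (L * ‖u‖))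
    (Metric.ball_mem_nhds _ one_pos)
    (Filter.Eventually.of_forall fun δ => ?_) ?_ ?_
    (Filter.Eventually.of_forall fun u => fun δ hδ => ?_)
    ((expInt_muU m n L).const_mul _)
    (Filter.Eventually.of_forall fun u => fun δ hδ => hf.at _ _)
  · simpa using h.2
  · simp only [← upd_add he]
    exact (hf.1.1.comp (measurable_upd_right v (ω + δ • e))).aestronglyMeasurable
  · simpa using integrable_upd hf.1 v ω
  · simpa using (integrable_upd hf.2.1 v ω).aestronglyMeasurable
  · rw [Real.norm_eq_abs, ← Real.exp_add]
    refine (hb _).trans (Real.exp_le_exp.2 ?_)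
    have h1 : ‖upd v ω u + δ • e‖ ≤ ‖ω‖ + ‖u‖ + ‖e‖ := by
      refine (norm_add_le _ _).trans (add_le_add (norm_upd v ω u) ?_)
      rw [norm_smul]
      have : ‖δ‖ < 1 := by simpa using hδ
      nlinarith [norm_nonneg e]
    nlinarith [mul_le_mul_of_nonneg_left h1 hL]

theorem Ex_sum {ι : Type*} (S : Finset ι) (v : Fin (r+1)) {f : ι → Om r m n → ℝ}
    (hf : ∀ i ∈ S, Tame (f i)) (ω : Om r m n) :
    Ex v (fun ω => ∑ i ∈ S, f i ω) ω = ∑ i ∈ S, Ex v (f i) ω :=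
  integral_finsetSum _ fun i hi => integrable_upd (hf i hi) v ω

theorem Ex_const_mul (v : Fin (r+1)) (c : ℝ) (f : Om r m n → ℝ) (ω : Om r m n) :
    Ex v (fun ω => c * f ω) ω = c * Ex v f ω :=
  integral_const_mul _ _

theorem Ex_add (v : Fin (r+1)) {f g : Om r m n → ℝ} (hf : Tame f) (hg : Tame g) (ω : Om r m n) :
    Ex v (fun ω => f ω + g ω) ω = Ex v f ω + Ex v g ω :=
  integral_add (integrable_upd hf v ω) (integrable_upd hg v ω)

theorem Ex_sub (v : Fin (r+1)) {f g : Om r m n → ℝ} (hf : Tame f) (hg : Tame g) (ω : Om r m n) :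
    Ex v (fun ω => f ω - g ω) ω = Ex v f ω - Ex v g ω :=
  integral_sub (integrable_upd hf v ω) (integrable_upd hg v ω)

theorem integral_Ex (v : Fin (r+1)) {f : Om r m n → ℝ} (hf : Tame f) :
    ∫ ω, Ex v f ω ∂muAll r m n = ∫ ω, f ω ∂muAll r m n := by
  have hi := hf.integrable (expInt_muAll r m n)
  have hi' := (tame_Ex hf v).integrable (expInt_muAll r m n)
  unfold muAll at hi hi' ⊢
  rw [integral_prod _ hi, integral_prod _ hi']
  congr 1
  funext G
  have hG : Tame (fun U : Fin (r+1) → Us m n => f (G, U)) := by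
    refine hf.comp (measurable_const.prodMk measurable_id) ‖G‖ (norm_nonneg _) fun U => ?_
    rw [Prod.norm_def]
    exact max_le (le_add_of_nonneg_left (norm_nonneg _)) (le_add_of_nonneg_right (norm_nonneg _))
  rw [integral_update_pi _ v _ (hG.integrable (ExpInt.pi fun _ => expInt_muU m n))]
  rfl

/-- Gaussian integration by parts in one coordinate of a Gaussian vector. -/
theorem stein_gVec {d : ℕ} (j : Fin d) {f f' : (Fin d → ℝ) → ℝ}
    (hf : DD (Pi.single j (1:ℝ)) f f') :
    ∫ h, h j * f h ∂gVec d = ∫ h, f' h ∂gVec d := by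
  have hj : Tame (fun h : Fin d → ℝ => h j) :=
    LinB.tame ⟨measurable_pi_apply j, 1, zero_le_one, fun h => by
      simpa using norm_le_pi_norm h j⟩
  unfold gVec
  rw [integral_update_pi _ j _ ((hj.mul hf.1).integrable (expInt_gVec d)),
    integral_update_pi _ j _ (hf.2.1.integrable (expInt_gVec d))]
  congr 1
  funext h
  simp only [Function.update_self]
  have hupd : ∀ {g : (Fin d → ℝ) → ℝ}, Tame g → Tame (fun z : ℝ => g (Function.update h j z)) := by
    intro g hg
    refine hg.comp (measurable_update h) ‖h‖ (norm_nonneg _) fun z => ?_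
    rw [pi_norm_le_iff_of_nonneg (by positivity)]
    intro i
    by_cases hi : i = j
    · subst hi
      simp
    · simp only [ne_eq, hi, not_false_eq_true, Function.update_of_ne]
      exact (norm_le_pi_norm h i).trans (le_add_of_nonneg_left (norm_nonneg _))
  have e1 : ∀ z : ℝ, Function.update h j z
      = Function.update h j 0 + z • (Pi.single j (1:ℝ) : Fin d → ℝ) := by
    intro z
    funext i
    by_cases hi : i = j
    · subst hi
      simp
    · simp [hi]
  refine stein_one (hupd hf.1) (hupd hf.2.1) fun z => ?_
  have := hf.at (Function.update h j 0) z
  simp only [← e1] at this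
  exact this

theorem stein_muU (j : Fin n) {f f' : Us m n → ℝ}
    (hf : DD ((0, 0, Pi.single j (1:ℝ)) : Us m n) f f') :
    ∫ u, u.2.2 j * f u ∂muU m n = ∫ u, f' u ∂muU m n := by
  have hj : Tame (fun u : Us m n => u.2.2 j) :=
    LinB.tame ⟨by fun_prop, 1, zero_le_one, fun u => by
      rw [one_mul]
      exact (norm_le_pi_norm u.2.2 j).trans ((norm_snd_le u.2).trans (norm_snd_le u))⟩
  have hA : ∀ {g : Us m n → ℝ}, Tame g → ∀ a, Tame (fun b : (Fin m → ℝ) × (Fin n → ℝ) => g (a, b)) := by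
    intro g hg a
    refine hg.comp (measurable_const.prodMk measurable_id) ‖a‖ (norm_nonneg _) fun U => ?_
    rw [Prod.norm_def]
    exact max_le (le_add_of_nonneg_left (norm_nonneg _)) (le_add_of_nonneg_right (norm_nonneg _))
  have hB : ∀ {g : (Fin m → ℝ) × (Fin n → ℝ) → ℝ}, Tame g → ∀ a, Tame (fun b => g (a, b)) := by
    intro g hg a
    refine hg.comp (measurable_const.prodMk measurable_id) ‖a‖ (norm_nonneg _) fun U => ?_
    rw [Prod.norm_def]
    exact max_le (le_add_of_nonneg_left (norm_nonneg _)) (le_add_of_nonneg_right (norm_nonneg _))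
  have hi := (hj.mul hf.1).integrable (expInt_muU m n)
  have hi' := hf.2.1.integrable (expInt_muU m n)
  unfold muU at hi hi' ⊢
  rw [integral_prod _ hi, integral_prod _ hi']
  congr 1
  funext a
  have hE := (expInt_gVec m).prod (expInt_gVec n)
  rw [integral_prod _ ((hA (hj.mul hf.1) a).integrable hE),
    integral_prod _ ((hA hf.2.1 a).integrable hE)]
  congr 1
  funext b
  refine stein_gVec j ⟨hB (hA hf.1 a) b, hB (hA hf.2.1 a) b, fun h => ?_⟩
  have := hf.2.2 (a, b, h)
  simpa using this

end ex

section abs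

variable {r : ℕ}

/-- Expectation over the `v`-th group, with a natural-number index. -/
def ExN (v : ℕ) (f : Om r m n → ℝ) : Om r m n → ℝ :=
  fun ω => if h : v < r + 1 then Ex ⟨v, h⟩ f ω else 0

theorem ExN_eq {v : ℕ} (h : v < r + 1) (f : Om r m n → ℝ) : ExN v f = Ex ⟨v, h⟩ f := by
  funext ω
  simp [ExN, h]

/-- Abstract version of `zetaR`. -/
def ze (mv : ℕ → ℝ) (Z : Om r m n → ℝ) : ℕ → Om r m n → ℝ
  | 0 => Z
  | k+1 => ExN k (fun ω => ze mv Z k ω ^ (mv (k+1) / mv k))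

/-- Abstract version of `nestR`. -/
def ne (mv : ℕ → ℝ) (Z g : Om r m n → ℝ) : ℕ → Om r m n → ℝ
  | 0 => g
  | v+1 => ExN v (fun ω => ze mv Z v ω ^ (mv (v+1) / mv v - 1) * ne mv Z g v ω)

/-- Abstract version of `PhiR`. -/
def ph (mv : ℕ → ℝ) (Z : Om r m n → ℝ) (k : ℕ) (f : Om r m n → ℝ) : Om r m n → ℝ :=
  fun ω => ExN (k-1) (fun ω => ze mv Z (k-1) ω ^ (mv k / mv (k-1)) * f ω) ω / ze mv Z k ω

/-- Abstract version of `PhiUpToR`. -/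
def phU (mv : ℕ → ℝ) (Z : Om r m n → ℝ) (lo : ℕ) : ℕ → (Om r m n → ℝ) → Om r m n → ℝ
  | 0, f => f
  | hi+1, f => if hi + 1 < lo then f else ph mv Z (hi+1) (phU mv Z lo hi f)

variable {mv : ℕ → ℝ} {Z : Om r m n → ℝ}

theorem ze_posTame (hZ : PosTame Z) : ∀ v, v ≤ r + 1 → PosTame (ze mv Z v)
  | 0, _ => hZ
  | v+1, hv => by
    unfold ze
    rw [ExN_eq (show v < r+1 by omega)]
    exact posTame_Ex ((ze_posTame hZ v (by omega)).rpow _) _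

theorem ne_tame (hZ : PosTame Z) {g : Om r m n → ℝ} (hg : Tame g) :
    ∀ v, v ≤ r + 1 → Tame (ne mv Z g v)
  | 0, _ => hg
  | v+1, hv => by
    unfold ne
    rw [ExN_eq (show v < r+1 by omega)]
    exact tame_Ex (((ze_posTame hZ v (by omega)).rpow_tame _).mul (ne_tame hZ hg v (by omega))) _

theorem ne_sum (hZ : PosTame Z) {ι : Type*} (S : Finset ι) (w : ι → ℝ) {g : ι → Om r m n → ℝ}
    (hg : ∀ i ∈ S, Tame (g i)) : ∀ v, v ≤ r + 1 →
    ne mv Z (fun ω => ∑ i ∈ S, w i * g i ω) v = fun ω => ∑ i ∈ S, w i * ne mv Z (g i) v ω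
  | 0, _ => rfl
  | v+1, hv => by
    funext ω
    unfold ne
    rw [ne_sum hZ S w hg v (by omega)]
    simp only [ExN_eq (show v < r+1 by omega)]
    simp only [← Ex_const_mul]
    rw [← Ex_sum]
    · congr 1
      funext ω
      rw [Finset.mul_sum]
      exact Finset.sum_congr rfl fun i _ => by ring
    · intro i hi
      exact (Tame.const _).mul (((ze_posTame hZ v (by omega)).rpow_tame _).mul
        (ne_tame hZ (hg i hi) v (by omega)))

theorem ph_tame (hZ : PosTame Z) {f : Om r m n → ℝ} (hf : Tame f) {k : ℕ} (hk : k ≤ r) :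
    Tame (ph mv Z k f) := by
  unfold ph
  rw [ExN_eq (show k - 1 < r+1 by omega)]
  simp only [div_eq_mul_inv (Ex _ _ _)]
  exact (tame_Ex (((ze_posTame hZ (k-1) (by omega)).rpow_tame _).mul hf) _).mul
    (ze_posTame hZ k (by omega)).2.2

theorem phU_tame (hZ : PosTame Z) {f : Om r m n → ℝ} (hf : Tame f) (lo : ℕ) :
    ∀ k, k ≤ r → Tame (phU mv Z lo k f)
  | 0, _ => hf
  | k+1, hk => by
    unfold phU
    split_ifs
    · exact hf
    · exact ph_tame hZ (phU_tame hZ hf lo k (by omega)) hk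

theorem phU_sum (hZ : PosTame Z) {ι : Type*} (S : Finset ι) (w : ι → ℝ) {f : ι → Om r m n → ℝ}
    (hf : ∀ i ∈ S, Tame (f i)) (lo : ℕ) : ∀ k, k ≤ r →
    phU mv Z lo k (fun ω => ∑ i ∈ S, w i * f i ω) = fun ω => ∑ i ∈ S, w i * phU mv Z lo k (f i) ω
  | 0, _ => rfl
  | k+1, hk => by
    unfold phU
    split_ifs
    · rfl
    · funext ω
      rw [phU_sum hZ S w hf lo k (by omega)]
      unfold ph
      simp only [ExN_eq (show k + 1 - 1 < r+1 by omega)]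
      simp only [← mul_div_assoc, ← Ex_const_mul]
      rw [← Finset.sum_div, ← Ex_sum]
      · congr 2
        funext ω
        rw [Finset.mul_sum]
        exact Finset.sum_congr rfl fun i _ => by ring
      · intro i hi
        exact (Tame.const _).mul (((ze_posTame hZ _ (by omega)).rpow_tame _).mul
          (phU_tame hZ (hf i hi) lo k (by omega)))

theorem phU_ne (hZ : PosTame Z) (g : Om r m n → ℝ) : ∀ k, k ≤ r →
    phU mv Z 1 k (fun ω => g ω / Z ω) = fun ω => ne mv Z g k ω / ze mv Z k ω
  | 0, _ => rfl
  | k+1, hk => by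
    unfold phU
    rw [if_neg (by omega), phU_ne hZ g k (by omega)]
    unfold ph
    funext ω
    congr 1
    conv_rhs => unfold ne
    simp only [Nat.add_sub_cancel]
    congr 1
    funext ω
    have h := (ze_posTame (mv := mv) hZ k (by omega)).2.1 ω
    rw [Real.rpow_sub_one h.ne']
    ring

theorem ze_DD {e : Om r m n} (he : ∀ v : Fin (r+1), (v : ℕ) < r → e.2 v = 0)
    (hZ : PosTame Z) {Z' : Om r m n → ℝ} (hZ' : DD e Z Z') (hm0 : mv 0 = 1)
    (hmpos : ∀ k, 1 ≤ k → k ≤ r → 0 < mv k) : ∀ v, v ≤ r →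
    DD e (ze mv Z v) (fun ω => mv v * ne mv Z Z' v ω)
  | 0, _ => by
    simpa [hm0, ze, ne] using hZ'
  | v+1, hv => by
    have ih := ze_DD he hZ hZ' hm0 hmpos v (by omega)
    unfold ze ne
    simp only [ExN_eq (show v < r+1 by omega)]
    have h := DD_Ex (he ⟨v, by omega⟩ (by simp; omega))
      (ih.rpow (ze_posTame hZ v (by omega)) (mv (v+1) / mv v))
    refine h.congr (fun ω => rfl) fun ω => ?_
    rw [← Ex_const_mul]
    congr 1
    funext ω
    have : mv v ≠ 0 := by
      rcases Nat.eq_zero_or_pos v with h | h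
      · rw [h, hm0]; exact one_ne_zero
      · exact (hmpos v h (by omega)).ne'
    field_simp

theorem ne_DD {e : Om r m n} (he : ∀ v : Fin (r+1), (v : ℕ) < r → e.2 v = 0)
    (hZ : PosTame Z) {Z' : Om r m n → ℝ} (hZ' : DD e Z Z') (hm0 : mv 0 = 1)
    (hmpos : ∀ k, 1 ≤ k → k ≤ r → 0 < mv k) {g g' : Om r m n → ℝ} (hg : DD e g g') : ∀ v, v ≤ r →
    ∃ f, DD e (ne mv Z g v) f
  | 0, _ => ⟨g', hg⟩
  | v+1, hv => by
    obtain ⟨f, ih⟩ := ne_DD he hZ hZ' hm0 hmpos hg v (by omega)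
    unfold ne
    simp only [ExN_eq (show v < r+1 by omega)]
    exact ⟨_, DD_Ex (he ⟨v, by omega⟩ (by simp; omega))
      (((ze_DD he hZ hZ' hm0 hmpos v (by omega)).rpow (ze_posTame hZ v (by omega)) _).mul ih)⟩

/-- Shift invariance: translations along both directions have the same effect on `f`. -/
def InvS (e e' : Om r m n) (f : Om r m n → ℝ) : Prop :=
  ∀ ω (δ : ℝ), f (ω + δ • e') = f (ω + δ • e)

theorem InvS_Ex {v : Fin (r+1)} {e e' : Om r m n} (he : e.2 v = 0) (he' : e'.2 v = 0)
    {f : Om r m n → ℝ} (hf : InvS e e' f) : InvS e e' (Ex v f) := by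
  intro ω δ
  unfold Ex
  simp only [upd_add he, upd_add he', hf _ δ]

theorem ze_InvS {κ : ℕ} (hκ : κ ≤ r) {e e' : Om r m n}
    (he : ∀ v : Fin (r+1), (v : ℕ) < κ → e.2 v = 0)
    (he' : ∀ v : Fin (r+1), (v : ℕ) < κ → e'.2 v = 0) (hZ : InvS e e' Z) : ∀ v, v ≤ κ →
    InvS e e' (ze mv Z v)
  | 0, _ => hZ
  | v+1, hv => by
    unfold ze
    rw [ExN_eq (show v < r+1 by omega)]
    refine InvS_Ex (he _ (by simp; omega)) (he' _ (by simp; omega)) fun ω δ => ?_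
    rw [ze_InvS hκ he he' hZ v (by omega) ω δ]

theorem ne_InvS {κ : ℕ} (hκ : κ ≤ r) {e e' : Om r m n}
    (he : ∀ v : Fin (r+1), (v : ℕ) < κ → e.2 v = 0)
    (he' : ∀ v : Fin (r+1), (v : ℕ) < κ → e'.2 v = 0) (hZ : InvS e e' Z)
    {g : Om r m n → ℝ} (hg : InvS e e' g) : ∀ v, v ≤ κ →
    InvS e e' (ne mv Z g v)
  | 0, _ => hg
  | v+1, hv => by
    unfold ne
    rw [ExN_eq (show v < r+1 by omega)]
    refine InvS_Ex (he _ (by simp; omega)) (he' _ (by simp; omega)) fun ω δ => ?_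
    rw [ze_InvS hκ he he' hZ v (by omega) ω δ, ne_InvS hκ he he' hZ hg v (by omega) ω δ]

/-- The coordinate `h_j` of group `κ`. -/
def hc (κ : ℕ) (j : Fin n) (ω : Om r m n) : ℝ := if h : κ < r + 1 then (ω.2 ⟨κ, h⟩).2.2 j else 0

theorem hc_tame (κ : ℕ) (j : Fin n) : LinB (hc (r := r) (m := m) κ j) := by
  unfold hc
  by_cases h : κ < r + 1
  · simp only [h, dite_true]
    refine ⟨by fun_prop, 1, zero_le_one, fun ω => ?_⟩
    rw [one_mul]
    exact (norm_le_pi_norm (ω.2 ⟨κ, h⟩).2.2 j).trans ((norm_snd_le (ω.2 ⟨κ, h⟩).2).trans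
      ((norm_snd_le (ω.2 ⟨κ, h⟩)).trans ((norm_le_pi_norm ω.2 _).trans (norm_snd_le ω))))
  · simp only [h, dite_false]
    exact ⟨measurable_const, 0, le_rfl, by simp⟩

/-- The unit direction of coordinate `h_j` of group `κ`. -/
def ej (κ : ℕ) (j : Fin n) : Om r m n :=
  (0, fun v => if (v : ℕ) = κ then (0, 0, Pi.single j (1:ℝ)) else 0)

theorem ne_pull (κ : ℕ) (j : Fin n) (g : Om r m n → ℝ) (hκ : κ ≤ r) : ∀ v, v ≤ κ →
    ne mv Z (fun ω => g ω * hc κ j ω) v = fun ω => ne mv Z g v ω * hc κ j ω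
  | 0, _ => rfl
  | v+1, hv => by
    unfold ne
    rw [ne_pull κ j g hκ v (by omega)]
    simp only [ExN_eq (show v < r+1 by omega)]
    funext ω
    rw [mul_comm, ← Ex_const_mul]
    unfold Ex
    congr 1
    funext u
    have h1 : hc κ j (upd ⟨v, by omega⟩ ω u) = hc κ j ω := by
      unfold hc upd
      simp only [show κ < r + 1 by omega, dite_true]
      rw [Function.update_of_ne]
      intro h
      have := congrArg Fin.val h
      simp at this
      omega
    beta_reduce
    rw [h1]
    ring

theorem stein_Ex {κ : ℕ} (hκ : κ < r + 1) (j : Fin n) {c : ℝ} (hcp : 0 < c) {e : Om r m n}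
    {f f' : Om r m n → ℝ} (hf : DD e f f') (hi : InvS e (c⁻¹ • ej κ j) f) :
    Ex ⟨κ, hκ⟩ (fun ω => hc κ j ω * f ω) = fun ω => c * Ex ⟨κ, hκ⟩ f' ω := by
  funext ω
  rw [← Ex_const_mul]
  unfold Ex
  have h1 : ∀ u, hc κ j (upd ⟨κ, hκ⟩ ω u) = u.2.2 j := by
    intro u
    simp [hc, upd, hκ]
  simp only [h1]
  refine stein_muU j (f := fun u => f (upd ⟨κ, hκ⟩ ω u))
    (f' := fun u => c * f' (upd ⟨κ, hκ⟩ ω u))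
    ⟨tame_upd hf.1 _ ω, (Tame.const c).mul (tame_upd hf.2.1 _ ω), fun u => ?_⟩
  have h2 : ∀ δ : ℝ, upd ⟨κ, hκ⟩ ω (u + δ • ((0, 0, Pi.single j (1:ℝ)) : Us m n))
      = upd ⟨κ, hκ⟩ ω u + (δ * c) • (c⁻¹ • (ej κ j : Om r m n)) := by
    intro δ
    rw [smul_smul, mul_assoc, mul_inv_cancel₀ hcp.ne', mul_one]
    unfold upd ej
    ext1
    · simp
    · funext v
      by_cases hv : v = ⟨κ, hκ⟩
      · subst hv
        simp
      · have : (v : ℕ) ≠ κ := fun h => hv (Fin.ext h)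
        simp [hv, this]
  simp only [h2]
  have hh : (fun δ : ℝ => f (upd ⟨κ, hκ⟩ ω u + (δ * c) • (c⁻¹ • (ej κ j : Om r m n))))
      = fun δ : ℝ => f (upd ⟨κ, hκ⟩ ω u + (δ * c) • e) := funext fun δ => hi _ _
  rw [hh]
  have h3 := hf.2.2 (upd ⟨κ, hκ⟩ ω u)
  have h4 : HasDerivAt (fun δ : ℝ => δ * c) c 0 := by
    simpa using (hasDerivAt_id (0:ℝ)).mul_const c
  have h5 := HasDerivAt.comp (0:ℝ) (h₂ := fun δ : ℝ => f (upd ⟨κ, hκ⟩ ω u + δ • e))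
    (h := fun δ : ℝ => δ * c) (h₂' := f' (upd ⟨κ, hκ⟩ ω u)) (h' := c) (by simpa using h3) h4
  exact h5.congr_deriv (mul_comm _ _)

/-- The recursion in abstract form. -/
theorem abs_rec (hZ : PosTame Z) {c : ℕ → ℝ} (hcp : ∀ k, k ≤ r → 0 < c k) (j : Fin n)
    (hm0 : mv 0 = 1) (hmr1 : mv (r+1) = 0) (hmpos : ∀ k, 1 ≤ k → k ≤ r → 0 < mv k)
    {Z' g g' : Om r m n → ℝ} (hZ' : DD ((c r)⁻¹ • ej r j) Z Z') (hg : DD ((c r)⁻¹ • ej r j) g g')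
    (hZi : ∀ κ, κ ≤ r → InvS ((c r)⁻¹ • ej r j) ((c κ)⁻¹ • ej κ j) Z)
    (hgi : ∀ κ, κ ≤ r → InvS ((c r)⁻¹ • ej r j) ((c κ)⁻¹ • ej κ j) g)
    (κ : ℕ) (hκ : κ + 1 ≤ r) :
    ∀ v, v + κ + 2 ≤ r + 1 →
    ∀ ω, (c (κ+1))⁻¹ * ne mv Z (fun ω => g ω * hc (κ+1) j ω) (v + κ + 2) ω
      - (c κ)⁻¹ * ne mv Z (fun ω => g ω * hc κ j ω) (v + κ + 2) ω
      = (mv (κ+2) - mv (κ+1)) * (ze mv Z (v + κ + 2) ω * phU mv Z (κ+2) (v + κ + 2)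
        (fun ω => ne mv Z g (κ+1) ω / ze mv Z (κ+1) ω
          * (ne mv Z Z' (κ+1) ω / ze mv Z (κ+1) ω)) ω) := by
  have hE : ∀ k, k ≤ r → ∀ v : Fin (r+1), (v : ℕ) < k →
      ((c k)⁻¹ • (ej k j : Om r m n)).2 v = 0 := by
    intro k hk v hv
    simp [ej, hv.ne]
  have hEr : ∀ k, k ≤ r → ∀ v : Fin (r+1), (v : ℕ) < k →
      ((c r)⁻¹ • (ej r j : Om r m n)).2 v = 0 := by
    intro k hk v hv
    exact hE r le_rfl v (by omega)
  have hne0 : mv (κ+1) ≠ 0 := (hmpos (κ+1) (by omega) hκ).ne'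
  intro v
  induction v with
  | zero =>
    intro _ ω
    simp only [Nat.zero_add]
    obtain ⟨N', hN'⟩ := ne_DD (mv := mv) (hEr r le_rfl) hZ hZ' hm0 hmpos hg κ (by omega)
    have hQ := ((ze_DD (mv := mv) (hEr r le_rfl) hZ hZ' hm0 hmpos κ (by omega)).rpow
      (ze_posTame hZ κ (by omega)) (mv (κ+1) / mv κ - 1)).mul hN'
    have hQi : InvS ((c r)⁻¹ • ej r j) ((c κ)⁻¹ • ej κ j)
        (fun ω => ze mv Z κ ω ^ (mv (κ+1) / mv κ - 1) * ne mv Z g κ ω) := by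
      intro ω δ
      beta_reduce
      rw [ze_InvS (κ := κ) (by omega) (hEr κ (by omega)) (hE κ (by omega)) (hZi κ (by omega)) κ
          le_rfl ω δ,
        ne_InvS (κ := κ) (by omega) (hEr κ (by omega)) (hE κ (by omega)) (hZi κ (by omega))
          (hgi κ (by omega)) κ le_rfl ω δ]
    have hS := stein_Ex (show κ < r + 1 by omega) j (hcp κ (by omega)) hQ hQi
    have hN1 := DD_Ex (hEr r le_rfl ⟨κ, by omega⟩ (by simp; omega)) hQ
    have hN1e : ne mv Z g (κ+1) = Ex ⟨κ, by omega⟩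
        (fun ω => ze mv Z κ ω ^ (mv (κ+1) / mv κ - 1) * ne mv Z g κ ω) := by
      conv_lhs => unfold ne
      rw [ExN_eq (show κ < r+1 by omega)]
    rw [← hN1e] at hN1
    have hA : ne mv Z (fun ω => g ω * hc κ j ω) (κ+1) = fun ω => c κ * Ex ⟨κ, by omega⟩
        (fun ω => (mv (κ+1) / mv κ - 1) * ze mv Z κ ω ^ (mv (κ+1) / mv κ - 1 - 1)
          * (mv κ * ne mv Z Z' κ ω) * ne mv Z g κ ω
          + ze mv Z κ ω ^ (mv (κ+1) / mv κ - 1) * N' ω) ω := by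
      rw [← hS]
      conv_lhs => unfold ne
      rw [ExN_eq (show κ < r+1 by omega), ne_pull κ j g (by omega) κ le_rfl]
      congr 1
      funext ω
      ring
    generalize hQ'def : (Ex (r := r) (m := m) (n := n) ⟨κ, by omega⟩
        (fun ω => (mv (κ+1) / mv κ - 1) * ze mv Z κ ω ^ (mv (κ+1) / mv κ - 1 - 1)
          * (mv κ * ne mv Z Z' κ ω) * ne mv Z g κ ω
          + ze mv Z κ ω ^ (mv (κ+1) / mv κ - 1) * N' ω)) = Q' at hA hN1
    have hzp := ze_posTame (mv := mv) hZ (κ+1) (by omega)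
    have hP := ((ze_DD (mv := mv) (hEr r le_rfl) hZ hZ' hm0 hmpos (κ+1) (by omega)).rpow
      hzp (mv (κ+2) / mv (κ+1) - 1)).mul hN1
    have hPi : InvS ((c r)⁻¹ • ej r j) ((c (κ+1))⁻¹ • ej (κ+1) j)
        (fun ω => ze mv Z (κ+1) ω ^ (mv (κ+2) / mv (κ+1) - 1) * ne mv Z g (κ+1) ω) := by
      intro ω δ
      beta_reduce
      rw [ze_InvS (κ := κ+1) (by omega) (hEr (κ+1) (by omega)) (hE (κ+1) (by omega))
          (hZi (κ+1) (by omega)) (κ+1) le_rfl ω δ,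
        ne_InvS (κ := κ+1) (by omega) (hEr (κ+1) (by omega)) (hE (κ+1) (by omega))
          (hZi (κ+1) (by omega)) (hgi (κ+1) (by omega)) (κ+1) le_rfl ω δ]
    have hS1 := stein_Ex (show κ + 1 < r + 1 by omega) j (hcp (κ+1) (by omega)) hP hPi
    have hB : ne mv Z (fun ω => g ω * hc (κ+1) j ω) (κ+2) = Ex ⟨κ+1, by omega⟩
        (fun ω => hc (κ+1) j ω *
          (ze mv Z (κ+1) ω ^ (mv (κ+2) / mv (κ+1) - 1) * ne mv Z g (κ+1) ω)) := by
      conv_lhs => unfold ne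
      rw [ExN_eq (show κ+1 < r+1 by omega), ne_pull (κ+1) j g (by omega) (κ+1) le_rfl]
      congr 1
      funext ω
      ring
    have hC : ne mv Z (fun ω => g ω * hc κ j ω) (κ+2) = fun ω => c κ * Ex ⟨κ+1, by omega⟩
        (fun ω => ze mv Z (κ+1) ω ^ (mv (κ+2) / mv (κ+1) - 1) * Q' ω) ω := by
      conv_lhs => unfold ne
      rw [ExN_eq (show κ+1 < r+1 by omega), hA]
      funext ω
      rw [← Ex_const_mul]
      congr 1
      funext ω
      ring
    have hc0 := (hcp κ (by omega)).ne'
    have hc1 := (hcp (κ+1) (by omega)).ne'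
    rw [hB, hC, hS1]
    beta_reduce
    rw [inv_mul_cancel_left₀ hc1, inv_mul_cancel_left₀ hc0]
    rw [← Ex_sub _ hP.2.1 ((hzp.rpow_tame _).mul hN1.2.1)]
    conv_rhs => unfold phU
    rw [if_neg (by omega)]
    unfold ph
    rw [mul_div_cancel₀ _ ((ze_posTame (mv := mv) hZ (κ+2) (by omega)).2.1 ω).ne']
    have hlow : phU mv Z (κ+2) (κ+1) (fun ω => ne mv Z g (κ+1) ω / ze mv Z (κ+1) ω
          * (ne mv Z Z' (κ+1) ω / ze mv Z (κ+1) ω)) = (fun ω => ne mv Z g (κ+1) ω / ze mv Z (κ+1) ω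
          * (ne mv Z Z' (κ+1) ω / ze mv Z (κ+1) ω)) := by
      unfold phU
      rw [if_pos (by omega)]
    rw [hlow]
    simp only [show κ + 2 - 1 = κ + 1 from rfl]
    rw [ExN_eq (show κ+1 < r+1 by omega), ← Ex_const_mul]
    congr 1
    funext ω
    have hz := hzp.2.1 ω
    rw [Real.rpow_sub_one hz.ne', Real.rpow_sub_one hz.ne']
    field_simp
    ring
  | succ v ih =>
    intro hv ω
    have ih := ih (by omega)
    have e : v + 1 + κ + 2 = (v + κ + 2) + 1 := by ring
    rw [e]
    generalize (fun ω => ne mv Z g (κ+1) ω / ze mv Z (κ+1) ω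
          * (ne mv Z Z' (κ+1) ω / ze mv Z (κ+1) ω)) = ψ at ih ⊢
    unfold ne
    conv_rhs => unfold phU
    rw [if_neg (by omega)]
    unfold ph
    rw [mul_div_cancel₀ _ ((ze_posTame (mv := mv) hZ (v+κ+2+1) (by omega)).2.1 ω).ne']
    simp only [Nat.add_sub_cancel, ExN_eq (show v + κ + 2 < r+1 by omega)]
    rw [← Ex_const_mul, ← Ex_const_mul, ← Ex_const_mul, ← Ex_sub]
    · congr 1
      funext ω
      have hz := (ze_posTame (mv := mv) hZ (v+κ+2) (by omega)).2.1 ω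
      have h := ih ω
      rw [Real.rpow_sub_one hz.ne']
      calc _ = ze mv Z (v+κ+2) ω ^ (mv (v+κ+2+1) / mv (v+κ+2)) / ze mv Z (v+κ+2) ω *
          ((c (κ+1))⁻¹ * ne mv Z (fun ω => g ω * hc (κ+1) j ω) (v + κ + 2) ω
      - (c κ)⁻¹ * ne mv Z (fun ω => g ω * hc κ j ω) (v + κ + 2) ω) := by ring
        _ = _ := by
          rw [h]
          field_simp
    · exact (Tame.const _).mul (((ze_posTame hZ _ (by omega)).rpow_tame _).mul
        (ne_tame hZ (hg.1.mul (hc_tame _ _).tame) _ (by omega)))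
    · exact (Tame.const _).mul (((ze_posTame hZ _ (by omega)).rpow_tame _).mul
        (ne_tame hZ (hg.1.mul (hc_tame _ _).tame) _ (by omega)))

/-- The outermost expectation written as one more nesting level. -/
theorem integral_top (hZ : PosTame Z) (hmr1 : mv (r+1) = 0) {g : Om r m n → ℝ} (hg : Tame g) :
    ∫ ω, (ze mv Z r ω)⁻¹ * ne mv Z g r ω ∂muAll r m n
      = ∫ ω, ne mv Z g (r+1) ω ∂muAll r m n := by
  have h : ne mv Z g (r+1) = Ex ⟨r, by omega⟩ (fun ω => (ze mv Z r ω)⁻¹ * ne mv Z g r ω) := by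
    conv_lhs => unfold ne
    rw [ExN_eq (show r < r+1 by omega)]
    simp only [hmr1, zero_div, zero_sub, Real.rpow_neg_one]
  rw [h, integral_Ex]
  exact (ze_posTame hZ r (by omega)).2.2.mul (ne_tame hZ hg r (by omega))

theorem abs_main (hZ : PosTame Z) {c : ℕ → ℝ} (hcp : ∀ k, k ≤ r → 0 < c k) (j : Fin n)
    (hm0 : mv 0 = 1) (hmr1 : mv (r+1) = 0) (hmpos : ∀ k, 1 ≤ k → k ≤ r → 0 < mv k)
    {Z' g g' : Om r m n → ℝ} (hZ' : DD ((c r)⁻¹ • ej r j) Z Z') (hg : DD ((c r)⁻¹ • ej r j) g g')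
    (hZi : ∀ κ, κ ≤ r → InvS ((c r)⁻¹ • ej r j) ((c κ)⁻¹ • ej κ j) Z)
    (hgi : ∀ κ, κ ≤ r → InvS ((c r)⁻¹ • ej r j) ((c κ)⁻¹ • ej κ j) g)
    {ι : Type*} (S : Finset ι) (w : ι → ℝ) (G : ι → Om r m n → ℝ) (hG : ∀ i ∈ S, Tame (G i))
    (hZG : ∀ ω, Z' ω = ∑ i ∈ S, w i * G i ω)
    (κ : ℕ) (hκ : κ + 1 ≤ r) :
    (c (κ+1))⁻¹ * (∫ ω, (ze mv Z r ω)⁻¹ * ne mv Z (fun ω => g ω * hc (κ+1) j ω) r ω ∂muAll r m n)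
      - (c κ)⁻¹ * (∫ ω, (ze mv Z r ω)⁻¹ * ne mv Z (fun ω => g ω * hc κ j ω) r ω ∂muAll r m n)
    = (mv (κ+2) - mv (κ+1)) * ∑ i ∈ S, w i * ∫ ω, phU mv Z (κ+2) r
        (fun ω => phU mv Z 1 (κ+1) (fun ω => g ω / Z ω) ω
          * phU mv Z 1 (κ+1) (fun ω => G i ω / Z ω) ω) ω ∂muAll r m n := by
  have hgh : ∀ k, Tame (fun ω => g ω * hc k j ω) := fun k => hg.1.mul (hc_tame _ _).tame
  rw [integral_top hZ hmr1 (hgh _), integral_top hZ hmr1 (hgh _), ← integral_const_mul,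
    ← integral_const_mul, ← integral_sub]
  rotate_left
  · exact ((ne_tame hZ (hgh _) _ le_rfl).integrable (expInt_muAll r m n)).const_mul _
  · exact ((ne_tame hZ (hgh _) _ le_rfl).integrable (expInt_muAll r m n)).const_mul _
  obtain ⟨v, hv⟩ : ∃ v, r + 1 = v + κ + 2 := ⟨r + 1 - κ - 2, by omega⟩
  have key := abs_rec hZ hcp j hm0 hmr1 hmpos hZ' hg hZi hgi κ hκ v hv.ge
  rw [← hv] at key
  simp only [key]
  rw [integral_const_mul]
  congr 1
  have hzt := (ze_posTame (mv := mv) hZ (κ+1) (by omega))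
  have hGt : ∀ i ∈ S, Tame (fun ω => ne mv Z g (κ+1) ω / ze mv Z (κ+1) ω
          * (ne mv Z (G i) (κ+1) ω / ze mv Z (κ+1) ω)) := by
    intro i hi
    simp only [div_eq_mul_inv]
    exact ((ne_tame hZ hg.1 _ (by omega)).mul hzt.2.2).mul
      ((ne_tame hZ (hG i hi) _ (by omega)).mul hzt.2.2)
  have hψ : (fun ω => ne mv Z g (κ+1) ω / ze mv Z (κ+1) ω
          * (ne mv Z Z' (κ+1) ω / ze mv Z (κ+1) ω))
      = fun ω => ∑ i ∈ S, w i * (ne mv Z g (κ+1) ω / ze mv Z (κ+1) ω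
          * (ne mv Z (G i) (κ+1) ω / ze mv Z (κ+1) ω)) := by
    rw [show Z' = fun ω => ∑ i ∈ S, w i * G i ω from funext hZG,
      ne_sum hZ S w hG (κ+1) (by omega)]
    funext ω
    rw [Finset.sum_div, Finset.mul_sum]
    exact Finset.sum_congr rfl fun i _ => by ring
  rw [hψ]
  have hψt := Tame.sum S (fun i hi => (Tame.const (w i)).mul (hGt i hi))
  have h1 : ∀ ω, ze mv Z (r+1) ω * phU mv Z (κ+2) (r+1)
      (fun ω => ∑ i ∈ S, w i * (ne mv Z g (κ+1) ω / ze mv Z (κ+1) ω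
          * (ne mv Z (G i) (κ+1) ω / ze mv Z (κ+1) ω))) ω
      = Ex ⟨r, by omega⟩ (phU mv Z (κ+2) r
      (fun ω => ∑ i ∈ S, w i * (ne mv Z g (κ+1) ω / ze mv Z (κ+1) ω
          * (ne mv Z (G i) (κ+1) ω / ze mv Z (κ+1) ω)))) ω := by
    intro ω
    conv_lhs => unfold phU
    rw [if_neg (by omega)]
    unfold ph
    rw [mul_div_cancel₀ _ ((ze_posTame (mv := mv) hZ (r+1) le_rfl).2.1 ω).ne']
    simp only [Nat.add_sub_cancel, ExN_eq (show r < r+1 by omega), hmr1, zero_div, Real.rpow_zero,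
      one_mul]
  simp only [h1]
  rw [integral_Ex _ (phU_tame hZ hψt _ _ le_rfl), phU_sum hZ S w hGt _ _ le_rfl]
  rw [integral_finsetSum]
  · refine Finset.sum_congr rfl fun i hi => ?_
    rw [integral_const_mul, phU_ne hZ g _ hκ, phU_ne hZ (G i) _ hκ]
  · intro i hi
    exact ((phU_tame hZ (hGt i hi) _ _ le_rfl).integrable (expInt_muAll r m n)).const_mul _

end abs

section concrete

variable {r : ℕ} (ε β s t : ℝ) (mv p q : ℕ → ℝ) (x : Fin l → Fin n → ℝ) (y : Fin l → Fin m → ℝ)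

/-- Uncurried `A`. -/
def Af (i1 i2 : Fin l) (ω : Om r m n) : ℝ := AR r ε β s t mv p q x y ω.1 ω.2 i1 i2
/-- Uncurried `C`. -/
def Cf (i1 : Fin l) (ω : Om r m n) : ℝ := CR r ε β s t mv p q x y ω.1 ω.2 i1
/-- Uncurried `Z`. -/
def Zf (ω : Om r m n) : ℝ := ZR r ε β s t mv p q x y ω.1 ω.2
/-- `C^{s-1} A`. -/
def gf (i1 i2 : Fin l) (ω : Om r m n) : ℝ :=
  Cf ε β s t mv p q x y i1 ω ^ (s - 1) * Af ε β s t mv p q x y i1 i2 ω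

theorem zetaR_eq (G : Fin m → Fin n → ℝ) : ∀ (k : ℕ) (U : Fin (r+1) → Us m n),
    zetaR r ε β s t mv p q x y G k U = ze mv (Zf ε β s t mv p q x y) k (G, U)
  | 0, U => rfl
  | k+1, U => by
    unfold zetaR ze ExN
    split_ifs with h
    · unfold Ex upd
      simp only [zetaR_eq G k]
    · rfl

theorem nestR_eq (g : (Fin m → Fin n → ℝ) → (Fin (r+1) → Us m n) → ℝ)
    (G : Fin m → Fin n → ℝ) : ∀ (k : ℕ) (U : Fin (r+1) → Us m n),
    nestR r ε β s t mv p q x y g k G U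
      = ne mv (Zf ε β s t mv p q x y) (fun ω => g ω.1 ω.2) k (G, U)
  | 0, U => rfl
  | k+1, U => by
    unfold nestR ne ExN
    split_ifs with h
    · unfold Ex upd
      simp only [nestR_eq g G k, zetaR_eq]
    · rfl

theorem PhiUpToR_eq (lo : ℕ) (f : (Fin m → Fin n → ℝ) → (Fin (r+1) → Us m n) → ℝ)
    (G : Fin m → Fin n → ℝ) : ∀ (k : ℕ) (U : Fin (r+1) → Us m n),
    PhiUpToR r ε β s t mv p q x y lo k f G U
      = phU mv (Zf ε β s t mv p q x y) lo k (fun ω => f ω.1 ω.2) (G, U)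
  | 0, U => rfl
  | k+1, U => by
    unfold PhiUpToR phU
    split_ifs with h
    · rfl
    · unfold PhiR ph ExN
      simp only [zetaR_eq]
      split_ifs with h'
      · unfold Ex upd
        simp only [PhiUpToR_eq lo f G k]
      · simp

theorem D0R_linB (i1 i2 : Fin l) :
    LinB (fun ω : Om r m n => D0R r ε β s t mv p q x y ω.1 ω.2 i1 i2) := by
  have hG : ∀ (j : Fin m) (k : Fin n), LinB (fun ω : Om r m n => ω.1 j k) := fun j k =>
    ⟨by fun_prop, 1, zero_le_one, fun ω => by
      rw [one_mul]
      exact (norm_le_pi_norm (ω.1 j) k).trans ((norm_le_pi_norm ω.1 j).trans (norm_fst_le ω))⟩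
  have hU : ∀ (k : Fin (r+1)) (ω : Om r m n), ‖ω.2 k‖ ≤ ‖ω‖ := fun k ω =>
    (norm_le_pi_norm ω.2 k).trans (norm_snd_le ω)
  have h1 : ∀ k : Fin (r+1), LinB (fun ω : Om r m n => (ω.2 k).1) := fun k =>
    ⟨by fun_prop, 1, zero_le_one, fun ω => by
      rw [one_mul]
      exact (norm_fst_le (ω.2 k)).trans (hU k ω)⟩
  have h2 : ∀ (k : Fin (r+1)) (j : Fin m), LinB (fun ω : Om r m n => (ω.2 k).2.1 j) := fun k j =>
    ⟨by fun_prop, 1, zero_le_one, fun ω => by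
      rw [one_mul]
      exact (norm_le_pi_norm (ω.2 k).2.1 j).trans ((norm_fst_le (ω.2 k).2).trans
        ((norm_snd_le (ω.2 k)).trans (hU k ω)))⟩
  have h3 : ∀ (k : Fin (r+1)) (j : Fin n), LinB (fun ω : Om r m n => (ω.2 k).2.2 j) := fun k j =>
    ⟨by fun_prop, 1, zero_le_one, fun ω => by
      rw [one_mul]
      exact (norm_le_pi_norm (ω.2 k).2.2 j).trans ((norm_snd_le (ω.2 k).2).trans
        ((norm_snd_le (ω.2 k)).trans (hU k ω)))⟩
  unfold D0R
  refine (((LinB.const_mul ?_ _).add (LinB.const_mul ?_ _)).add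
    (LinB.const_mul (LinB.const_mul ?_ _) _)).add (LinB.const_mul ?_ _)
  · exact LinB.sum _ fun j _ => LinB.sum _ fun k _ => ((hG j k).mul_const _).const_mul _
  · exact LinB.sum _ fun j _ => (LinB.sum _ fun k _ => (h2 k j).const_mul _).const_mul _
  · exact LinB.sum _ fun k _ => (h1 k).const_mul _
  · exact LinB.sum _ fun j _ => (LinB.sum _ fun k _ => (h3 k j).const_mul _).mul_const _

theorem Af_pos (i1 i2 : Fin l) : PosTame (Af (r := r) ε β s t mv p q x y i1 i2) :=
  LinB.exp ((D0R_linB ε β s t mv p q x y i1 i2).const_mul β)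

theorem Cf_pos [NeZero l] (i1 : Fin l) : PosTame (Cf (r := r) ε β s t mv p q x y i1) :=
  PosTame.sum Finset.univ Finset.univ_nonempty fun i2 _ => Af_pos ε β s t mv p q x y i1 i2

theorem Zf_pos [NeZero l] : PosTame (Zf (r := r) ε β s t mv p q x y) :=
  PosTame.sum Finset.univ Finset.univ_nonempty fun i1 _ => (Cf_pos ε β s t mv p q x y i1).rpow s

theorem gf_tame [NeZero l] (i1 i2 : Fin l) : Tame (gf (r := r) ε β s t mv p q x y i1 i2) :=
  ((Cf_pos ε β s t mv p q x y i1).rpow_tame _).mul (Af_pos ε β s t mv p q x y i1 i2).1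

/-- `c_{κ+1}`. -/
def cq (κ : ℕ) : ℝ := Real.sqrt (q κ - q (κ+1))

theorem D0R_shift {κ : ℕ} (hκ : κ ≤ r) (hc : 0 < cq q κ) (j : Fin n) (ω : Om r m n) (δ : ℝ)
    (i1 i2 : Fin l) :
    D0R r ε β s t mv p q x y (ω + δ • ((cq q κ)⁻¹ • (ej κ j : Om r m n))).1
        (ω + δ • ((cq q κ)⁻¹ • (ej κ j : Om r m n))).2 i1 i2
      = D0R r ε β s t mv p q x y ω.1 ω.2 i1 i2
        + δ * (Real.sqrt (1 - t) * nrm2 (y i2) * x i1 j) := by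
  have e1 : (ω + δ • ((cq q κ)⁻¹ • (ej κ j : Om r m n))).1 = ω.1 := by simp [ej]
  have e2 : ∀ k, ((ω + δ • ((cq q κ)⁻¹ • (ej κ j : Om r m n))).2 k).1 = (ω.2 k).1 := by
    intro k
    by_cases h : (k : ℕ) = κ <;> simp [ej, h]
  have e3 : ∀ k j', ((ω + δ • ((cq q κ)⁻¹ • (ej κ j : Om r m n))).2 k).2.1 j'
      = (ω.2 k).2.1 j' := by
    intro k j'
    by_cases h : (k : ℕ) = κ <;> simp [ej, h]
  have e4 : ∀ k j', ((ω + δ • ((cq q κ)⁻¹ • (ej κ j : Om r m n))).2 k).2.2 j'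
      = (ω.2 k).2.2 j' + (if k = ⟨κ, by omega⟩ then (if j' = j then δ * (cq q κ)⁻¹ else 0) else 0) := by
    intro k j'
    have hk : (k = ⟨κ, by omega⟩) ↔ (k : ℕ) = κ := Fin.ext_iff
    rw [if_congr hk rfl rfl]
    by_cases h : (k : ℕ) = κ
    · by_cases h' : j' = j
      · subst h'; simp [ej, h]
      · simp [ej, h, h']
    · simp [ej, h]
  unfold D0R
  simp only [e1, e2, e3, e4]
  have e5 : (∑ kk, (∑ k : Fin (r+1), Real.sqrt (q (k : ℕ) - q ((k : ℕ) + 1)) *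
        ((ω.2 k).2.2 kk + (if k = ⟨κ, by omega⟩ then (if kk = j then δ * (cq q κ)⁻¹ else 0) else 0)))
          * x i1 kk)
      = (∑ kk, (∑ k : Fin (r+1), Real.sqrt (q (k : ℕ) - q ((k : ℕ) + 1)) * (ω.2 k).2.2 kk)
          * x i1 kk) + δ * x i1 j := by
    simp only [mul_add, Finset.sum_add_distrib, mul_ite, mul_zero, Finset.sum_ite_eq',
      Finset.mem_univ, if_true, add_mul, ite_mul, zero_mul]
    congr 1
    have : Real.sqrt (q κ - q (κ+1)) = cq q κ := rfl
    rw [this]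
    field_simp
  rw [e5]
  ring

theorem Af_shift {κ : ℕ} (hκ : κ ≤ r) (hc : 0 < cq q κ) (j : Fin n) (ω : Om r m n) (δ : ℝ)
    (i1 i2 : Fin l) :
    Af ε β s t mv p q x y i1 i2 (ω + δ • ((cq q κ)⁻¹ • (ej κ j : Om r m n)))
      = Real.exp (β * D0R r ε β s t mv p q x y ω.1 ω.2 i1 i2
        + δ * (β * (Real.sqrt (1 - t) * nrm2 (y i2) * x i1 j))) := by
  unfold Af AR
  rw [D0R_shift ε β s t mv p q x y hκ hc]
  congr 1
  ring

theorem Af_DD {κ : ℕ} (hκ : κ ≤ r) (hc : 0 < cq q κ) (j : Fin n) (i1 i2 : Fin l) :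
    DD ((cq q κ)⁻¹ • (ej κ j : Om r m n)) (Af ε β s t mv p q x y i1 i2)
      (fun ω => (β * (Real.sqrt (1 - t) * nrm2 (y i2) * x i1 j))
        * Af ε β s t mv p q x y i1 i2 ω) := by
  have hA := (Af_pos (r := r) ε β s t mv p q x y i1 i2).1
  refine ⟨hA, (Tame.const _).mul hA, fun ω => ?_⟩
  simp only [Af_shift ε β s t mv p q x y hκ hc]
  have h1 : HasDerivAt (fun δ : ℝ => β * D0R r ε β s t mv p q x y ω.1 ω.2 i1 i2
        + δ * (β * (Real.sqrt (1 - t) * nrm2 (y i2) * x i1 j)))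
      (β * (Real.sqrt (1 - t) * nrm2 (y i2) * x i1 j)) 0 := by
    have := ((hasDerivAt_id (0:ℝ)).mul_const
      (β * (Real.sqrt (1 - t) * nrm2 (y i2) * x i1 j))).const_add
      (β * D0R r ε β s t mv p q x y ω.1 ω.2 i1 i2)
    rw [one_mul] at this
    exact this
  refine h1.exp.congr_deriv ?_
  unfold Af AR
  rw [zero_mul, add_zero, mul_comm]

theorem Cf_DD {κ : ℕ} (hκ : κ ≤ r) (hc : 0 < cq q κ) (j : Fin n) (i1 : Fin l) :
    DD ((cq q κ)⁻¹ • (ej κ j : Om r m n)) (Cf ε β s t mv p q x y i1)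
      (fun ω => ∑ i2, (β * (Real.sqrt (1 - t) * nrm2 (y i2) * x i1 j))
        * Af ε β s t mv p q x y i1 i2 ω) :=
  DD.sum Finset.univ fun i2 _ => Af_DD ε β s t mv p q x y hκ hc j i1 i2

theorem Zf_DD [NeZero l] {κ : ℕ} (hκ : κ ≤ r) (hc : 0 < cq q κ) (j : Fin n) :
    DD ((cq q κ)⁻¹ • (ej κ j : Om r m n)) (Zf ε β s t mv p q x y)
      (fun ω => ∑ i : Fin l × Fin l, (s * β * Real.sqrt (1 - t) * nrm2 (y i.2) * x i.1 j)
        * gf ε β s t mv p q x y i.1 i.2 ω) := by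
  have h := DD.sum Finset.univ fun i1 _ => (Cf_DD ε β s t mv p q x y hκ hc j i1).rpow
    (Cf_pos (r := r) ε β s t mv p q x y i1) s
  refine h.congr (fun ω => rfl) fun ω => ?_
  rw [Fintype.sum_prod_type]
  refine Finset.sum_congr rfl fun i1 _ => ?_
  rw [Finset.mul_sum]
  refine Finset.sum_congr rfl fun i2 _ => ?_
  unfold gf
  ring

theorem gf_DD [NeZero l] {κ : ℕ} (hκ : κ ≤ r) (hc : 0 < cq q κ) (j : Fin n) (i1 i2 : Fin l) :
    ∃ g', DD ((cq q κ)⁻¹ • (ej κ j : Om r m n)) (gf ε β s t mv p q x y i1 i2) g' :=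
  ⟨_, ((Cf_DD ε β s t mv p q x y hκ hc j i1).rpow
    (Cf_pos (r := r) ε β s t mv p q x y i1) (s-1)).mul (Af_DD ε β s t mv p q x y hκ hc j i1 i2)⟩

theorem Af_InvS {κ : ℕ} (hκ : κ ≤ r) (hc : 0 < cq q κ) (hc' : 0 < cq q r) (j : Fin n)
    (i1 i2 : Fin l) : InvS ((cq q r)⁻¹ • (ej r j : Om r m n)) ((cq q κ)⁻¹ • ej κ j)
      (Af ε β s t mv p q x y i1 i2) := by
  intro ω δ
  rw [Af_shift ε β s t mv p q x y hκ hc, Af_shift ε β s t mv p q x y le_rfl hc']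

theorem Cf_InvS {κ : ℕ} (hκ : κ ≤ r) (hc : 0 < cq q κ) (hc' : 0 < cq q r) (j : Fin n)
    (i1 : Fin l) : InvS ((cq q r)⁻¹ • (ej r j : Om r m n)) ((cq q κ)⁻¹ • ej κ j)
      (Cf ε β s t mv p q x y i1) := by
  intro ω δ
  show (∑ i2, Af ε β s t mv p q x y i1 i2 _) = ∑ i2, Af ε β s t mv p q x y i1 i2 _
  exact Finset.sum_congr rfl fun i2 _ => Af_InvS ε β s t mv p q x y hκ hc hc' j i1 i2 ω δ

theorem Zf_InvS {κ : ℕ} (hκ : κ ≤ r) (hc : 0 < cq q κ) (hc' : 0 < cq q r) (j : Fin n) :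
    InvS ((cq q r)⁻¹ • (ej r j : Om r m n)) ((cq q κ)⁻¹ • ej κ j)
      (Zf ε β s t mv p q x y) := by
  intro ω δ
  show (∑ i1, Cf ε β s t mv p q x y i1 _ ^ s) = ∑ i1, Cf ε β s t mv p q x y i1 _ ^ s
  exact Finset.sum_congr rfl fun i1 _ => congrArg (· ^ s) (Cf_InvS ε β s t mv p q x y hκ hc hc' j i1 ω δ)

theorem gf_InvS {κ : ℕ} (hκ : κ ≤ r) (hc : 0 < cq q κ) (hc' : 0 < cq q r) (j : Fin n)
    (i1 i2 : Fin l) : InvS ((cq q r)⁻¹ • (ej r j : Om r m n)) ((cq q κ)⁻¹ • ej κ j)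
      (gf ε β s t mv p q x y i1 i2) := by
  intro ω δ
  unfold gf
  rw [Cf_InvS ε β s t mv p q x y hκ hc hc' j i1 ω δ,
    Af_InvS ε β s t mv p q x y hκ hc hc' j i1 i2 ω δ]

/-- The coordinate building block of `TqR`. -/
def Ij (r : ℕ) (κ : ℕ) (j : Fin n) (i1 i2 : Fin l) : ℝ :=
  ∫ ω, (ze mv (Zf ε β s t mv p q x y) r ω)⁻¹ * ne mv (Zf ε β s t mv p q x y)
    (fun ω => gf ε β s t mv p q x y i1 i2 ω * hc κ j ω) r ω ∂muAll r m n

/-- The expectation of `γ(i,p)`. -/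
def Jf (r : ℕ) (k : ℕ) (i1 i2 p1 p2 : Fin l) : ℝ :=
  ∫ ω, gamR r ε β s t mv p q x y k i1 i2 p1 p2 ω.1 ω.2 ∂muAll r m n

theorem nrm2_pos {d : ℕ} {v : Fin d → ℝ} (hv : v ≠ 0) : 0 < nrm2 v := by
  unfold nrm2
  apply Real.sqrt_pos.2
  obtain ⟨i, hi⟩ := Function.ne_iff.1 hv
  exact Finset.sum_pos' (fun i _ => sq_nonneg _) ⟨i, Finset.mem_univ i, by
    have : v i ≠ 0 := hi
    positivity⟩

theorem TqR_eq [NeZero l] (κ : ℕ) (hκ : κ ≤ r) (i1 i2 : Fin l) (hx : x i1 ≠ 0) :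
    nrm2 (x i1) * TqR r ε β s t mv p q x y (κ+1) i1 i2
      = ∑ j, x i1 j * Ij ε β s t mv p q x y r κ j i1 i2 := by
  have hZ := Zf_pos (r := r) ε β s t mv p q x y
  have hgt : ∀ j ∈ Finset.univ (α := Fin n),
      Tame (fun ω => gf (r := r) ε β s t mv p q x y i1 i2 ω * hc κ j ω) := fun j _ =>
    (gf_tame ε β s t mv p q x y i1 i2).mul (hc_tame κ j).tame
  unfold TqR Ij
  simp only [zetaR_eq, nestR_eq]
  have h1 : (fun ω : Om r m n => CR r ε β s t mv p q x y ω.1 ω.2 i1 ^ (s - 1) *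
      AR r ε β s t mv p q x y ω.1 ω.2 i1 i2 * u3c x ω.2 (κ+1) i1)
      = fun ω => ∑ j, ((nrm2 (x i1))⁻¹ * x i1 j)
        * (gf ε β s t mv p q x y i1 i2 ω * hc κ j ω) := by
    funext ω
    unfold u3c gf Cf Af hc dotv
    simp only [Nat.add_sub_cancel, show κ < r + 1 by omega, dite_true]
    rw [div_eq_inv_mul, Finset.mul_sum, Finset.mul_sum]
    exact Finset.sum_congr rfl fun j _ => by ring
  rw [h1, ne_sum hZ _ _ hgt r (by omega), ← integral_const_mul]
  simp only [← integral_const_mul]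
  rw [← integral_finsetSum]
  · congr 1
    funext ω
    rw [Finset.mul_sum, Finset.mul_sum]
    refine Finset.sum_congr rfl fun j _ => ?_
    have := (nrm2_pos hx).ne'
    field_simp
  · intro j hj
    exact (((ze_posTame hZ r (by omega)).2.2.mul
      (ne_tame hZ (hgt j hj) r (by omega))).integrable (expInt_muAll r m n)).const_mul _

theorem gam0_eq [NeZero l] (i1 i2 : Fin l) :
    (fun ω : Om r m n => gam0R r ε β s t mv p q x y i1 i2 ω.1 ω.2)
      = fun ω => gf ε β s t mv p q x y i1 i2 ω / Zf ε β s t mv p q x y ω := by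
  funext ω
  unfold gam0R gf
  have h : 0 < Cf ε β s t mv p q x y i1 ω := (Cf_pos ε β s t mv p q x y i1).2.1 ω
  rw [Real.rpow_sub_one h.ne']
  unfold Cf Af Zf
  ring

theorem gamR_eq [NeZero l] (k : ℕ) (i1 i2 p1 p2 : Fin l) (ω : Om r m n) :
    gamR r ε β s t mv p q x y k i1 i2 p1 p2 ω.1 ω.2
      = phU mv (Zf ε β s t mv p q x y) (k+1) r
        (fun ω => phU mv (Zf ε β s t mv p q x y) 1 k
            (fun ω => gf ε β s t mv p q x y i1 i2 ω / Zf ε β s t mv p q x y ω) ω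
          * phU mv (Zf ε β s t mv p q x y) 1 k
            (fun ω => gf ε β s t mv p q x y p1 p2 ω / Zf ε β s t mv p q x y ω) ω) ω := by
  unfold gamR
  simp only [PhiUpToR_eq, gam0_eq]

theorem gamR_tame [NeZero l] (k : ℕ) (hk : k ≤ r) (i1 i2 p1 p2 : Fin l) :
    Tame (fun ω : Om r m n => gamR r ε β s t mv p q x y k i1 i2 p1 p2 ω.1 ω.2) := by
  have hZ := Zf_pos (r := r) ε β s t mv p q x y
  have hg : ∀ i1 i2, Tame (fun ω : Om r m n =>
      gf ε β s t mv p q x y i1 i2 ω / Zf ε β s t mv p q x y ω) := by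
    intro i1 i2
    simp only [div_eq_mul_inv]
    exact (gf_tame ε β s t mv p q x y i1 i2).mul hZ.2.2
  simp only [gamR_eq]
  exact phU_tame hZ ((phU_tame hZ (hg i1 i2) 1 k hk).mul (phU_tame hZ (hg p1 p2) 1 k hk)) _ _ le_rfl

theorem EBrR_eq [NeZero l] (k : ℕ) (hk : k ≤ r) (f : Fin l → Fin l → Fin l → Fin l → ℝ) :
    EBrR r ε β s t mv p q x y k f = ∑ i1, ∑ i2, ∑ p1, ∑ p2,
      f i1 i2 p1 p2 * Jf ε β s t mv p q x y r k i1 i2 p1 p2 := by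
  have hI : ∀ i1 i2 p1 p2, Integrable (fun ω : Om r m n => f i1 i2 p1 p2 *
      gamR r ε β s t mv p q x y k i1 i2 p1 p2 ω.1 ω.2) (muAll r m n) := fun i1 i2 p1 p2 =>
    ((gamR_tame ε β s t mv p q x y k hk i1 i2 p1 p2).integrable (expInt_muAll r m n)).const_mul _
  unfold EBrR Jf
  rw [integral_finsetSum _ fun i1 _ => integrable_finsetSum _ fun i2 _ =>
    integrable_finsetSum _ fun p1 _ => integrable_finsetSum _ fun p2 _ => hI i1 i2 p1 p2]
  refine Finset.sum_congr rfl fun i1 _ => ?_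
  rw [integral_finsetSum _ fun i2 _ =>
    integrable_finsetSum _ fun p1 _ => integrable_finsetSum _ fun p2 _ => hI i1 i2 p1 p2]
  refine Finset.sum_congr rfl fun i2 _ => ?_
  rw [integral_finsetSum _ fun p1 _ => integrable_finsetSum _ fun p2 _ => hI i1 i2 p1 p2]
  refine Finset.sum_congr rfl fun p1 _ => ?_
  rw [integral_finsetSum _ fun p2 _ => hI i1 i2 p1 p2]
  refine Finset.sum_congr rfl fun p2 _ => ?_
  rw [integral_const_mul]

theorem Ij_rec [NeZero l] (hm0 : mv 0 = 1) (hmr1 : mv (r+1) = 0)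
    (hmpos : ∀ k, 1 ≤ k → k ≤ r → 0 < mv k) (hcp : ∀ k, k ≤ r → 0 < cq q k)
    (κ : ℕ) (hκ : κ + 1 ≤ r) (j : Fin n) (i1 i2 : Fin l) :
    (cq q (κ+1))⁻¹ * Ij ε β s t mv p q x y r (κ+1) j i1 i2
      - (cq q κ)⁻¹ * Ij ε β s t mv p q x y r κ j i1 i2
      = (mv (κ+2) - mv (κ+1)) * ∑ p1, ∑ p2,
        (s * β * Real.sqrt (1 - t) * nrm2 (y p2) * x p1 j)
          * Jf ε β s t mv p q x y r (κ+1) i1 i2 p1 p2 := by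
  obtain ⟨g', hg'⟩ := gf_DD (r := r) ε β s t mv p q x y le_rfl (hcp r le_rfl) j i1 i2
  have h := abs_main (c := cq q) (Zf_pos (r := r) ε β s t mv p q x y) hcp j hm0 hmr1 hmpos
    (Zf_DD ε β s t mv p q x y le_rfl (hcp r le_rfl) j) hg'
    (fun k hk => Zf_InvS ε β s t mv p q x y hk (hcp k hk) (hcp r le_rfl) j)
    (fun k hk => gf_InvS ε β s t mv p q x y hk (hcp k hk) (hcp r le_rfl) j i1 i2)
    (ι := Fin l × Fin l) Finset.univ
    (fun i => s * β * Real.sqrt (1 - t) * nrm2 (y i.2) * x i.1 j)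
    (fun i => gf ε β s t mv p q x y i.1 i.2)
    (fun i _ => gf_tame ε β s t mv p q x y i.1 i.2) (fun ω => rfl) κ hκ
  have hL : (cq q (κ+1))⁻¹ * Ij ε β s t mv p q x y r (κ+1) j i1 i2
      - (cq q κ)⁻¹ * Ij ε β s t mv p q x y r κ j i1 i2 = _ := h
  rw [hL]
  congr 1
  rw [Fintype.sum_prod_type]
  refine Finset.sum_congr rfl fun p1 _ => Finset.sum_congr rfl fun p2 _ => ?_
  congr 1
  unfold Jf
  congr 1
  funext ω
  exact (gamR_eq ε β s t mv p q x y (κ+1) i1 i2 p1 p2 ω).symm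

end concrete

/-- `r`-th level scaled-cancellation recursion for the sequence `T^q_{k,2}`. -/
theorem rth_level_recursion_Tq
    (r m n l : ℕ) (hr : 1 ≤ r) (hm : 1 ≤ m) (hn : 1 ≤ n) (hl : 1 ≤ l)
    (β s t : ℝ) (hβ : 0 < β) (hs : s ≠ 0) (ht : t ∈ Set.Ioo (0:ℝ) 1)
    (mv p q : ℕ → ℝ)
    (hm0 : mv 0 = 1) (hmr1 : mv (r+1) = 0) (hmpos : ∀ k, 1 ≤ k → k ≤ r → 0 < mv k)
    (hp0 : p 0 ≤ 1) (hpmono : ∀ k ≤ r, p (k+1) ≤ p k) (hpend : p (r+1) = 0)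
    (hq0 : q 0 ≤ 1) (hqmono : ∀ k ≤ r, q (k+1) ≤ q k) (hqend : q (r+1) = 0)
    (x : Fin l → Fin n → ℝ) (y : Fin l → Fin m → ℝ)
    (hx : ∀ i, x i ≠ 0) (hy : ∀ i, y i ≠ 0)
    (hqstrict : ∀ k < r, q (k+1) < q k) (hqrpos : 0 < q r) :
    ∀ k1, 1 ≤ k1 → k1 ≤ r →
      (∑ i1, ∑ i2, β * nrm2 (x i1) * nrm2 (y i2) *
          (Real.sqrt (1 - t) / Real.sqrt (q k1 - q (k1+1)) * TqR r 1 β s t mv p q x y (k1+1) i1 i2))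
        = (∑ i1, ∑ i2, β * nrm2 (x i1) * nrm2 (y i2) *
            (Real.sqrt (1 - t) / Real.sqrt (q (k1-1) - q k1) * TqR r 1 β s t mv p q x y k1 i1 i2))
          - (1 - t) * s * β ^ 2 * (mv k1 - mv (k1+1)) * EBrR r 1 β s t mv p q x y k1 (fun i1 i2 pp1 pp2 => dotv (x pp1) (x i1) * (nrm2 (y i2) * nrm2 (y pp2))) := by
  have : NeZero l := ⟨by omega⟩
  intro k1 hk1 hk1r
  obtain ⟨κ, rfl⟩ : ∃ κ, k1 = κ + 1 := ⟨k1 - 1, by omega⟩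
  have hcp : ∀ k, k ≤ r → 0 < cq q k := by
    intro k hk
    apply Real.sqrt_pos.2
    rcases hk.lt_or_eq with h | h
    · exact sub_pos.2 (hqstrict k h)
    · subst h
      rw [hqend, sub_zero]
      exact hqrpos
  have ht1 : Real.sqrt (1 - t) * Real.sqrt (1 - t) = 1 - t :=
    Real.mul_self_sqrt (by linarith [ht.2])
  have hS : ∀ k, k ≤ r → (∑ i1, ∑ i2, β * nrm2 (x i1) * nrm2 (y i2) *
      (Real.sqrt (1 - t) / cq q k * TqR r 1 β s t mv p q x y (k+1) i1 i2))
      = ∑ i1, ∑ i2, ∑ j, (β * nrm2 (y i2) * Real.sqrt (1 - t) * x i1 j) *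
        ((cq q k)⁻¹ * Ij 1 β s t mv p q x y r k j i1 i2) := by
    intro k hk
    refine Finset.sum_congr rfl fun i1 _ => Finset.sum_congr rfl fun i2 _ => ?_
    have h := TqR_eq (r := r) 1 β s t mv p q x y k hk i1 i2 (hx i1)
    calc _ = (β * nrm2 (y i2) * Real.sqrt (1 - t) * (cq q k)⁻¹) *
          (nrm2 (x i1) * TqR r 1 β s t mv p q x y (k+1) i1 i2) := by
            rw [div_eq_mul_inv]; ring
      _ = _ := by
        rw [h, Finset.mul_sum]
        exact Finset.sum_congr rfl fun j _ => by ring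
  rw [Nat.add_sub_cancel]
  have e1 := hS (κ+1) hk1r
  have e0 := hS κ (by omega)
  have e1' : (∑ i1, ∑ i2, β * nrm2 (x i1) * nrm2 (y i2) *
          (Real.sqrt (1 - t) / Real.sqrt (q (κ+1) - q (κ+1+1)) *
            TqR r 1 β s t mv p q x y (κ+1+1) i1 i2)) = _ := e1
  have e0' : (∑ i1, ∑ i2, β * nrm2 (x i1) * nrm2 (y i2) *
          (Real.sqrt (1 - t) / Real.sqrt (q κ - q (κ+1)) *
            TqR r 1 β s t mv p q x y (κ+1) i1 i2)) = _ := e0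
  rw [e1', e0', EBrR_eq 1 β s t mv p q x y (κ+1) hk1r]
  rw [eq_sub_iff_add_eq, ← eq_sub_iff_add_eq', ← Finset.sum_sub_distrib, Finset.mul_sum]
  refine Finset.sum_congr rfl fun i1 _ => ?_
  rw [← Finset.sum_sub_distrib, Finset.mul_sum]
  refine Finset.sum_congr rfl fun i2 _ => ?_
  rw [← Finset.sum_sub_distrib]
  have hj : ∀ j, (β * nrm2 (y i2) * Real.sqrt (1 - t) * x i1 j) *
        ((cq q κ)⁻¹ * Ij 1 β s t mv p q x y r κ j i1 i2)
      - (β * nrm2 (y i2) * Real.sqrt (1 - t) * x i1 j) *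
        ((cq q (κ+1))⁻¹ * Ij 1 β s t mv p q x y r (κ+1) j i1 i2)
      = ∑ p1, ∑ p2, ((1 - t) * s * β ^ 2 * (mv (κ+1) - mv (κ+2))) *
        (x p1 j * x i1 j * (nrm2 (y i2) * nrm2 (y p2))
          * Jf 1 β s t mv p q x y r (κ+1) i1 i2 p1 p2) := by
    intro j
    have h := Ij_rec 1 β s t mv p q x y hm0 hmr1 hmpos hcp κ hk1r j i1 i2
    rw [← mul_sub, ← neg_sub ((cq q (κ+1))⁻¹ * _), h, ← neg_mul, ← mul_assoc, Finset.mul_sum]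
    refine Finset.sum_congr rfl fun p1 _ => ?_
    rw [Finset.mul_sum]
    refine Finset.sum_congr rfl fun p2 _ => ?_
    linear_combination (β * nrm2 (y i2) * x i1 j * (mv (κ+1) - mv (κ+2)) * s * β * nrm2 (y p2)
      * x p1 j * Jf 1 β s t mv p q x y r (κ+1) i1 i2 p1 p2) * ht1
  symm
  rw [Finset.sum_congr rfl fun j _ => hj j, Finset.sum_comm, Finset.mul_sum]
  refine Finset.sum_congr rfl fun p1 _ => ?_
  rw [Finset.sum_comm, Finset.mul_sum]
  refine Finset.sum_congr rfl fun p2 _ => ?_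
  unfold dotv
  rw [← Finset.mul_sum, Finset.sum_mul, Finset.sum_mul]

end

end SFLR
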